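/- arXiv:1603.08125 — 2 statements merged into one kernel-verified Lean document; each statement's English description precedes it below -/
import Mathlib

section
/- Let k ≥ 1 be a fixed integer and let Y_{n,k} be the number of fringe subtrees with exactly k nodes in the linear preferential attachment tree Λ_n with n nodes. Then, as n → ∞, n^{−1/2}(Y_{n,k} − E Y_{n,k}) converges in distribution to N(0, σ_k²), where σ_k² is a positive constant. Furthermore, n^{−1/2}(Y_{n,k} − κ·n/((k + κ − 1)(k + κ))) also converges in distribution to N(0, σ_k²), where κ := ρ/(χ+ρ) = w_0/w_1. -/
open scoped BigOperators

namespace PATpaper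

/-- The sample space of the preferential attachment tree with `n` nodes: node `i + 1`
(for `0 ≤ i < n - 1`) chooses its parent among the nodes `0, …, i`. -/
abbrev Omega (n : ℕ) := ∀ i : Fin (n - 1), Fin ((i : ℕ) + 1)

/-- The list of parents: entry `i` is the parent of node `i + 1`. -/
def toList {n : ℕ} (p : Omega n) : List ℕ := (List.finRange (n - 1)).map (fun i => ((p i : ℕ)))

/-- The probability, in the linear preferential attachment model with weights
`w_k = χ k + ρ`, of a given parent list: at the step adding node `i + 1` to the tree
with nodes `0, …, i`, an existing node `v` is chosen as the parent with probability
`w_{d⁺(v)}` divided by the total weight `(i+1)(χ+ρ) − χ` of the current tree. -/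
noncomputable def prob (χ ρ : ℝ) (l : List ℕ) : ℝ :=
  ∏ i ∈ Finset.range l.length,
    ((χ * ((l.take i).count (l.getD i 0) : ℝ) + ρ) / (((i : ℝ) + 1) * (χ + ρ) - χ))

/-- Expectation of a functional of the linear preferential attachment tree with
`n` nodes. -/
noncomputable def expec (χ ρ : ℝ) (n : ℕ) (f : Omega n → ℝ) : ℝ :=
  ∑ p : Omega n, prob χ ρ (toList p) * f p

/-- The list of weak ancestors of node `u` (for a valid parent list, the parent of a
node is smaller than the node, and `min` is idle). -/
def anc (l : List ℕ) : ℕ → List ℕ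
  | 0 => [0]
  | (u + 1) => (u + 1) :: anc l (min (l.getD u 0) u)
decreasing_by exact Nat.lt_succ_of_le (Nat.min_le_right _ _)

open Classical in
/-- The set of (weak) descendants of node `v` among the nodes `0, …, n - 1`:
the vertex set of the fringe subtree rooted at `v`. -/
noncomputable def descSet (l : List ℕ) (n v : ℕ) : Finset ℕ :=
  (Finset.range n).filter (fun u => v ∈ anc l u)

open Classical in
/-- The number of fringe subtrees with exactly `k` nodes. -/
noncomputable def countSize (l : List ℕ) (n k : ℕ) : ℕ :=
  ((Finset.range n).filter (fun v => (descSet l n v).card = k)).card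

open Classical in
/-- The number of nodes with out-degree `k`. -/
noncomputable def countDeg (l : List ℕ) (n k : ℕ) : ℕ :=
  ((Finset.range n).filter (fun v => l.count v = k)).card

open MeasureTheory in
/-- `W_n` converges in distribution, under the linear preferential attachment model,
to the centered normal distribution with variance `v`. -/
def TendstoGaussP (χ ρ : ℝ) (W : (n : ℕ) → Omega n → ℝ) (v : NNReal) : Prop :=
  ∀ f : BoundedContinuousFunction ℝ ℝ,
    Filter.Tendsto (fun n => expec χ ρ n (fun p => f (W n p)))
      Filter.atTop (nhds (∫ x, f x ∂(ProbabilityTheory.gaussianReal 0 v)))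

end PATpaper

namespace PATpaper

/-- The admissible parameters of the linear preferential attachment model. -/
structure Admissible (χ ρ : ℝ) : Prop where
  slope : χ = -1 ∨ χ = 0 ∨ χ = 1
  pos : 0 < ρ
  integral : χ = -1 → ∃ m : ℕ, 2 ≤ m ∧ ρ = m

/-- The probability that the next node is attached to `v`. -/
noncomputable def attachProb (χ ρ : ℝ) (l : List ℕ) (v : ℕ) : ℝ :=
  (χ * (l.count v : ℝ) + ρ) / (((l.length : ℝ) + 1) * (χ + ρ) - χ)

/-- The conditional expectation, given the current parent list `l`, of a function of the next
parent. -/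
noncomputable def avg {E : Type*} [NormedAddCommGroup E] [NormedSpace ℝ E] (χ ρ : ℝ)
    (l : List ℕ) (g : ℕ → E) : E :=
  ∑ v ∈ Finset.range (l.length + 1), attachProb χ ρ l v • g v

/-- The expectation of a functional of the parent list of the tree with `n` nodes. -/
noncomputable def ex {E : Type*} [NormedAddCommGroup E] [NormedSpace ℝ E] (χ ρ : ℝ)
    (n : ℕ) (F : List ℕ → E) : E :=
  ∑ p : Omega n, prob χ ρ (toList p) • F (toList p)

/-- Parent lists that occur with positive probability. -/
inductive Reach (χ ρ : ℝ) : List ℕ → Prop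
  | nil : Reach χ ρ []
  | snoc {l : List ℕ} {v : ℕ} (hl : Reach χ ρ l) (hv : v ≤ l.length)
      (hw : 0 < χ * (l.count v : ℝ) + ρ) : Reach χ ρ (l ++ [v])

section Model
variable {χ ρ : ℝ}

lemma Admissible.add_pos (h : Admissible χ ρ) : 0 < χ + ρ := by
  rcases h.slope with h1 | h1 | h1
  · obtain ⟨m, hm, rfl⟩ := h.integral h1
    have : (2 : ℝ) ≤ m := by exact_mod_cast hm
    linarith
  · have := h.pos; linarith
  · have := h.pos; linarith

lemma Admissible.total_pos (h : Admissible χ ρ) (n : ℕ) :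
    0 < ((n : ℝ) + 1) * (χ + ρ) - χ := by
  have h1 := h.add_pos
  have h2 := h.pos
  have : 0 ≤ (n : ℝ) * (χ + ρ) := by positivity
  nlinarith

lemma Reach.le_length {l : List ℕ} (hl : Reach χ ρ l) : ∀ v ∈ l, v < l.length := by
  induction hl with
  | nil => simp
  | snoc hl hv hw ih =>
    intro v hv'
    simp only [List.mem_append, List.mem_singleton] at hv'
    rcases hv' with h | h
    · have := ih v h; simp; omega
    · subst h; simp; omega

lemma Reach.weight_nonneg (h : Admissible χ ρ) {l : List ℕ} (hl : Reach χ ρ l) (v : ℕ) :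
    0 ≤ χ * (l.count v : ℝ) + ρ := by
  have hp := h.pos
  rcases h.slope with h1 | h1 | h1
  · obtain ⟨m, hm, rfl⟩ := h.integral h1
    suffices l.count v ≤ m by
      have : (l.count v : ℝ) ≤ m := by exact_mod_cast this
      rw [h1]; linarith
    induction hl with
    | nil => simp
    | @snoc l u hl hu hw ih =>
      by_cases huv : u = v
      · subst huv
        rw [h1] at hw
        have : (l.count u : ℝ) < m := by linarith
        have : l.count u < m := by exact_mod_cast this
        simp; omega
      · simp [List.count_append, huv]; exact ih
  · rw [h1]; linarith
  · rw [h1]; positivity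

lemma Reach.attachProb_nonneg (h : Admissible χ ρ) {l : List ℕ} (hl : Reach χ ρ l) (v : ℕ) :
    0 ≤ attachProb χ ρ l v :=
  div_nonneg (hl.weight_nonneg h v) (h.total_pos _).le

lemma Reach.snoc_of_attachProb_ne (h : Admissible χ ρ) {l : List ℕ} (hl : Reach χ ρ l) {v : ℕ}
    (hv : v ≤ l.length) (hw : attachProb χ ρ l v ≠ 0) : Reach χ ρ (l ++ [v]) := by
  refine hl.snoc hv (lt_of_le_of_ne (hl.weight_nonneg h v) ?_)
  intro h0
  exact hw (by rw [attachProb, ← h0, zero_div])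

lemma prob_snoc (l : List ℕ) (v : ℕ) :
    prob χ ρ (l ++ [v]) = prob χ ρ l * attachProb χ ρ l v := by
  unfold prob attachProb
  simp only [List.length_append, List.length_singleton]
  rw [Finset.prod_range_succ]
  congr 1
  · refine Finset.prod_congr rfl fun i hi => ?_
    have hi := Finset.mem_range.1 hi
    rw [List.take_append_of_le_length hi.le, List.getD_append _ _ _ _ hi]
  · rw [List.getD_append_right _ _ _ _ le_rfl]
    simp

lemma toList_length {n : ℕ} (p : Omega n) : (toList p).length = n - 1 := by
  simp [toList]

lemma toList_snoc {m : ℕ} (p : Omega (m + 1)) (v : Fin (m + 1)) :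
    toList (n := m + 2) (Fin.snoc (α := fun i : Fin (m + 1) => Fin ((i : ℕ) + 1)) p v)
      = toList p ++ [(v : ℕ)] := by
  unfold toList
  have h : List.finRange (m + 1) = (List.finRange m).map Fin.castSucc ++ [Fin.last m] :=
    List.finRange_succ_last
  change List.map _ (List.finRange (m + 1)) = _
  rw [h]
  simp only [List.map_append, List.map_map, List.map_singleton]
  congr 1
  · refine List.map_congr_left fun i _ => ?_
    simp only [Function.comp]
    rw [Fin.snoc_castSucc]
  · rw [Fin.snoc_last]

variable {E : Type*} [NormedAddCommGroup E] [NormedSpace ℝ E]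

lemma ex_one (F : List ℕ → E) : ex χ ρ 1 F = F [] := by
  unfold ex
  have : Unique (Omega 1) := ⟨⟨fun i => i.elim0⟩, fun p => funext fun i => i.elim0⟩
  rw [Fintype.sum_unique]
  simp [toList, prob]

lemma ex_succ {n : ℕ} (hn : 1 ≤ n) (F : List ℕ → E) :
    ex χ ρ (n + 1) F = ex χ ρ n (fun l => avg χ ρ l fun v => F (l ++ [v])) := by
  obtain ⟨m, rfl⟩ : ∃ m, n = m + 1 := ⟨n - 1, by omega⟩
  unfold ex
  have := (Fin.snocEquiv (fun i : Fin (m + 1) => Fin ((i : ℕ) + 1))).sum_comp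
    (fun p : Omega (m + 2) => prob χ ρ (toList p) • F (toList p))
  refine this.symm.trans ?_
  rw [Fintype.sum_prod_type, Finset.sum_comm]
  refine Finset.sum_congr rfl fun p _ => ?_
  unfold avg
  beta_reduce
  have hl : (toList (n := m + 1) p).length = m := toList_length (n := m + 1) p
  rw [hl, Finset.smul_sum, ← Fin.sum_univ_eq_sum_range
    (fun v => prob χ ρ (toList (n := m + 1) p) • attachProb χ ρ (toList (n := m + 1) p) v •
      F (toList (n := m + 1) p ++ [v]))]
  refine Finset.sum_congr rfl fun v _ => ?_
  have h2 := toList_snoc (m := m) p v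
  simp only [Fin.snocEquiv, Equiv.coe_fn_mk]
  rw [smul_smul, ← prob_snoc, ← h2]

lemma prob_toList (h : Admissible χ ρ) {n : ℕ} (hn : 1 ≤ n) (p : Omega n) :
    0 ≤ prob χ ρ (toList p) ∧ (prob χ ρ (toList p) ≠ 0 → Reach χ ρ (toList p)) := by
  induction n, hn using Nat.le_induction with
  | base => simpa [toList, prob] using Reach.nil
  | succ n hn ih =>
    obtain ⟨m, rfl⟩ : ∃ m, n = m + 1 := ⟨n - 1, by omega⟩
    obtain ⟨⟨v, q⟩, rfl⟩ := (Fin.snocEquiv (fun i : Fin (m + 1) => Fin ((i : ℕ) + 1))).surjective p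
    have h2 := toList_snoc (m := m) q v
    have h3 : toList (n := m + 1 + 1)
        ((Fin.snocEquiv (fun i : Fin (m + 1) => Fin ((i : ℕ) + 1))) (v, q))
        = toList (n := m + 1) q ++ [(v : ℕ)] := h2
    rw [h3, prob_snoc]
    obtain ⟨i1, i2⟩ := ih q
    have hlen : (toList (n := m + 1) q).length = m := toList_length (n := m + 1) q
    have hv : (v : ℕ) ≤ (toList (n := m + 1) q).length := by rw [hlen]; exact Nat.lt_succ_iff.1 v.2
    by_cases h0 : prob χ ρ (toList (n := m + 1) q) = 0
    · simp [h0]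
    · have hr := i2 h0
      exact ⟨mul_nonneg i1 (hr.attachProb_nonneg h _), fun hne =>
        hr.snoc_of_attachProb_ne h hv (right_ne_zero_of_mul hne)⟩

lemma ex_add (n : ℕ) (F G : List ℕ → E) :
    ex χ ρ n (fun l => F l + G l) = ex χ ρ n F + ex χ ρ n G := by
  simp [ex, smul_add, Finset.sum_add_distrib]

lemma ex_sub (n : ℕ) (F G : List ℕ → E) :
    ex χ ρ n (fun l => F l - G l) = ex χ ρ n F - ex χ ρ n G := by
  simp [ex, smul_sub, Finset.sum_sub_distrib]

lemma ex_sum {ι : Type*} (n : ℕ) (s : Finset ι) (F : ι → List ℕ → E) :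
    ex χ ρ n (fun l => ∑ i ∈ s, F i l) = ∑ i ∈ s, ex χ ρ n (F i) := by
  simp only [ex, Finset.smul_sum]
  exact Finset.sum_comm

lemma ex_const_mul {𝕜 : Type*} [NormedField 𝕜] [NormedAlgebra ℝ 𝕜] (n : ℕ) (c : 𝕜)
    (F : List ℕ → 𝕜) :
    ex χ ρ n (fun l => c * F l) = c * ex χ ρ n F := by
  simp [ex, Finset.mul_sum]

lemma avg_add (l : List ℕ) (F G : ℕ → E) :
    avg χ ρ l (fun v => F v + G v) = avg χ ρ l F + avg χ ρ l G := by
  simp [avg, smul_add, Finset.sum_add_distrib]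

lemma avg_sub (l : List ℕ) (F G : ℕ → E) :
    avg χ ρ l (fun v => F v - G v) = avg χ ρ l F - avg χ ρ l G := by
  simp [avg, smul_sub, Finset.sum_sub_distrib]

lemma avg_sum {ι : Type*} (l : List ℕ) (s : Finset ι) (F : ι → ℕ → E) :
    avg χ ρ l (fun v => ∑ i ∈ s, F i v) = ∑ i ∈ s, avg χ ρ l (F i) := by
  simp only [avg, Finset.smul_sum]
  exact Finset.sum_comm

lemma avg_const_mul {𝕜 : Type*} [NormedField 𝕜] [NormedAlgebra ℝ 𝕜] (l : List ℕ) (c : 𝕜)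
    (F : ℕ → 𝕜) :
    avg χ ρ l (fun v => c * F v) = c * avg χ ρ l F := by
  simp [avg, Finset.mul_sum]

lemma sum_count_of_lt (l : List ℕ) (N : ℕ) (hl : ∀ v ∈ l, v < N) :
    ∑ v ∈ Finset.range N, l.count v = l.length := by
  induction l with
  | nil => simp
  | cons a l ih =>
    have ha : a ∈ Finset.range N := Finset.mem_range.2 (hl a (by simp))
    simp [List.count_cons, Finset.sum_add_distrib, ih fun v hv => hl v (by simp [hv])]
    exact Finset.mem_range.1 ha

lemma Reach.sum_attachProb (h : Admissible χ ρ) {l : List ℕ} (hl : Reach χ ρ l) :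
    ∑ v ∈ Finset.range (l.length + 1), attachProb χ ρ l v = 1 := by
  have h1 := sum_count_of_lt l (l.length + 1) fun v hv => (hl.le_length v hv).trans (by omega)
  have h2 : ∑ v ∈ Finset.range (l.length + 1), (l.count v : ℝ) = l.length := by
    exact_mod_cast h1
  simp only [attachProb]
  rw [← Finset.sum_div, Finset.sum_add_distrib, ← Finset.mul_sum, h2,
    div_eq_one_iff_eq (h.total_pos _).ne']
  simp
  ring

lemma Reach.avg_const (h : Admissible χ ρ) {l : List ℕ} (hl : Reach χ ρ l) (c : E) :
    avg χ ρ l (fun _ => c) = c := by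
  rw [avg, ← Finset.sum_smul, hl.sum_attachProb h, one_smul]

lemma Reach.avg_congr (h : Admissible χ ρ) {l : List ℕ} (hl : Reach χ ρ l) {F G : ℕ → E}
    (hFG : ∀ v ≤ l.length, Reach χ ρ (l ++ [v]) → F v = G v) :
    avg χ ρ l F = avg χ ρ l G := by
  refine Finset.sum_congr rfl fun v hv => ?_
  by_cases h0 : attachProb χ ρ l v = 0
  · simp [h0]
  · have hv := Nat.lt_succ_iff.1 (Finset.mem_range.1 hv)
    rw [hFG v hv (hl.snoc_of_attachProb_ne h hv h0)]

lemma Reach.avg_mono (h : Admissible χ ρ) {l : List ℕ} (hl : Reach χ ρ l) {F G : ℕ → ℝ}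
    (hFG : ∀ v ≤ l.length, Reach χ ρ (l ++ [v]) → F v ≤ G v) :
    avg χ ρ l F ≤ avg χ ρ l G := by
  refine Finset.sum_le_sum fun v hv => ?_
  by_cases h0 : attachProb χ ρ l v = 0
  · simp [h0]
  · have hv := Nat.lt_succ_iff.1 (Finset.mem_range.1 hv)
    exact mul_le_mul_of_nonneg_left (hFG v hv (hl.snoc_of_attachProb_ne h hv h0))
      (hl.attachProb_nonneg h v)

lemma Reach.norm_avg_le (h : Admissible χ ρ) {l : List ℕ} (hl : Reach χ ρ l) {F : ℕ → E}
    {C : ℝ} (hF : ∀ v ≤ l.length, Reach χ ρ (l ++ [v]) → ‖F v‖ ≤ C) :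
    ‖avg χ ρ l F‖ ≤ C := by
  calc ‖avg χ ρ l F‖ ≤ avg χ ρ l (fun v => ‖F v‖) := by
        refine (norm_sum_le _ _).trans (Finset.sum_le_sum fun v _ => ?_)
        rw [norm_smul, Real.norm_of_nonneg (hl.attachProb_nonneg h v), smul_eq_mul]
    _ ≤ avg χ ρ l (fun _ => C) := hl.avg_mono h hF
    _ = C := hl.avg_const h C

lemma ex_mono (h : Admissible χ ρ) {n : ℕ} (hn : 1 ≤ n) {F G : List ℕ → ℝ}
    (hFG : ∀ l, Reach χ ρ l → l.length + 1 = n → F l ≤ G l) : ex χ ρ n F ≤ ex χ ρ n G := by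
  refine Finset.sum_le_sum fun p _ => ?_
  obtain ⟨h1, h2⟩ := prob_toList h hn p
  by_cases h0 : prob χ ρ (toList p) = 0
  · simp [h0]
  · refine mul_le_mul_of_nonneg_left (hFG _ (h2 h0) ?_) h1
    rw [toList_length]; omega

lemma ex_congr (h : Admissible χ ρ) {n : ℕ} (hn : 1 ≤ n) {F G : List ℕ → E}
    (hFG : ∀ l, Reach χ ρ l → l.length + 1 = n → F l = G l) : ex χ ρ n F = ex χ ρ n G := by
  refine Finset.sum_congr rfl fun p _ => ?_
  obtain ⟨h1, h2⟩ := prob_toList h hn p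
  by_cases h0 : prob χ ρ (toList p) = 0
  · simp [h0]
  · rw [hFG _ (h2 h0)]
    rw [toList_length]; omega

lemma ex_const (h : Admissible χ ρ) {n : ℕ} (hn : 1 ≤ n) (c : E) :
    ex χ ρ n (fun _ => c) = c := by
  induction n, hn using Nat.le_induction with
  | base => exact ex_one _
  | succ n hn ih =>
    rw [ex_succ hn, ← ih]
    exact ex_congr h hn fun l hl _ => by rw [hl.avg_const h, ih]

lemma norm_ex_le (h : Admissible χ ρ) {n : ℕ} (hn : 1 ≤ n) (F : List ℕ → E) :
    ‖ex χ ρ n F‖ ≤ ex χ ρ n (fun l => ‖F l‖) := by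
  refine (norm_sum_le _ _).trans (Finset.sum_le_sum fun p _ => ?_)
  rw [norm_smul, Real.norm_of_nonneg (prob_toList h hn p).1, smul_eq_mul]

lemma ex_nonneg (h : Admissible χ ρ) {n : ℕ} (hn : 1 ≤ n) {F : List ℕ → ℝ}
    (hF : ∀ l, Reach χ ρ l → l.length + 1 = n → 0 ≤ F l) : 0 ≤ ex χ ρ n F := by
  rw [← ex_const h hn (0 : ℝ)]
  exact ex_mono h hn hF

lemma sq_ex_abs_le (h : Admissible χ ρ) {n : ℕ} (hn : 1 ≤ n) (F : List ℕ → ℝ) :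
    (ex χ ρ n (fun l => |F l|)) ^ 2 ≤ ex χ ρ n (fun l => F l ^ 2) := by
  set a := ex χ ρ n (fun l => |F l|) with ha
  have h1 : 0 ≤ ex χ ρ n (fun l => (|F l| - a) ^ 2) :=
    ex_nonneg h hn fun l _ _ => sq_nonneg _
  have h2 : ex χ ρ n (fun l => (|F l| - a) ^ 2)
      = ex χ ρ n (fun l => F l ^ 2) - 2 * a * a + a ^ 2 := by
    have : (fun l => (|F l| - a) ^ 2) = fun l => (F l ^ 2 - (2 * a) * |F l|) + a ^ 2 := by
      funext l; rw [← sq_abs (F l)]; ring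
    rw [this, ex_add, ex_sub, ex_const_mul, ex_const h hn, ← ha]
  nlinarith

end Model
end PATpaper

namespace PATpaper

/-- The vertex set of the fringe subtree rooted at `v`, in the tree with parent list `l`. -/
noncomputable abbrev desc (l : List ℕ) (v : ℕ) : Finset ℕ := descSet l (l.length + 1) v

section Trees

lemma anc_zero (l : List ℕ) : anc l 0 = [0] := by rw [anc]

lemma anc_succ (l : List ℕ) (u : ℕ) :
    anc l (u + 1) = (u + 1) :: anc l (min (l.getD u 0) u) := by rw [anc]

lemma mem_anc_self (l : List ℕ) (u : ℕ) : u ∈ anc l u := by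
  cases u with
  | zero => simp [anc_zero]
  | succ u => simp [anc_succ]

lemma le_of_mem_anc (l : List ℕ) {u v : ℕ} (h : v ∈ anc l u) : v ≤ u := by
  induction u using Nat.strong_induction_on with
  | _ u ih =>
    cases u with
    | zero => simpa [anc_zero] using h
    | succ u =>
      rw [anc_succ, List.mem_cons] at h
      rcases h with h | h
      · exact h.le
      · have := ih _ (Nat.lt_succ_of_le (min_le_right _ _)) h
        have := min_le_right (l.getD u 0) u
        omega

lemma anc_trans (l : List ℕ) {u v w : ℕ} (h : v ∈ anc l u) (h2 : w ∈ anc l v) : w ∈ anc l u := by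
  induction u using Nat.strong_induction_on with
  | _ u ih =>
    cases u with
    | zero =>
      have : v = 0 := by simpa [anc_zero] using h
      rwa [this] at h2
    | succ u =>
      rw [anc_succ, List.mem_cons] at h
      rcases h with h | h
      · rwa [h] at h2
      · rw [anc_succ, List.mem_cons]
        exact Or.inr (ih _ (Nat.lt_succ_of_le (min_le_right _ _)) h)

lemma anc_linear (l : List ℕ) {u v w : ℕ} (h : v ∈ anc l u) (h2 : w ∈ anc l u) (hvw : v ≤ w) :
    v ∈ anc l w := by
  induction u using Nat.strong_induction_on with
  | _ u ih =>
    cases u with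
    | zero =>
      have h3 : w = 0 := by simpa [anc_zero] using h2
      rwa [h3]
    | succ u =>
      have h' := h
      rw [anc_succ, List.mem_cons] at h h2
      rcases h2 with h2 | h2
      · rwa [h2]
      · rcases h with h | h
        · have := le_of_mem_anc l h2
          have := min_le_right (l.getD u 0) u
          omega
        · exact ih _ (Nat.lt_succ_of_le (min_le_right _ _)) h h2

lemma anc_snoc_of_le (l : List ℕ) (x : ℕ) {u : ℕ} (hu : u ≤ l.length) :
    anc (l ++ [x]) u = anc l u := by
  induction u using Nat.strong_induction_on with
  | _ u ih =>
    cases u with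
    | zero => simp [anc_zero]
    | succ u =>
      rw [anc_succ, anc_succ, List.getD_append _ _ _ _ hu]
      have := min_le_right (l.getD u 0) u
      rw [ih _ (Nat.lt_succ_of_le this) (by omega)]

lemma anc_snoc_last (l : List ℕ) {x : ℕ} (hx : x ≤ l.length) :
    anc (l ++ [x]) (l.length + 1) = (l.length + 1) :: anc l x := by
  rw [anc_succ, List.getD_append_right _ _ _ _ le_rfl]
  simp only [Nat.sub_self, List.getD_cons_zero, min_eq_left hx]
  rw [anc_snoc_of_le _ _ hx]

lemma mem_desc {l : List ℕ} {u v : ℕ} : u ∈ desc l v ↔ u ≤ l.length ∧ v ∈ anc l u := by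
  simp [descSet]

lemma self_mem_desc {l : List ℕ} {v : ℕ} (hv : v ≤ l.length) : v ∈ desc l v :=
  mem_desc.2 ⟨hv, mem_anc_self l v⟩

lemma desc_subset {l : List ℕ} {u v : ℕ} (h : u ∈ desc l v) : desc l u ⊆ desc l v := by
  intro w hw
  rw [mem_desc] at *
  exact ⟨hw.1, anc_trans l hw.2 h.2⟩

lemma desc_card_lt {l : List ℕ} {u v : ℕ} (h : u ∈ desc l v) (huv : u ≠ v) :
    (desc l u).card < (desc l v).card := by
  refine Finset.card_lt_card ⟨desc_subset h, fun h2 => ?_⟩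
  have hu := mem_desc.1 h
  have hle := le_of_mem_anc l hu.2
  have := mem_desc.1 (h2 (self_mem_desc (hle.trans hu.1)))
  have := le_of_mem_anc l this.2
  omega

lemma desc_nested {l : List ℕ} {u v x : ℕ} (hu : x ∈ desc l u) (hv : x ∈ desc l v)
    (h : (desc l u).card ≤ (desc l v).card) : u ∈ desc l v := by
  rw [mem_desc] at hu hv
  have hu1 := (le_of_mem_anc l hu.2).trans hu.1
  have hv1 := (le_of_mem_anc l hv.2).trans hv.1
  rcases le_total v u with hvu | hvu
  · exact mem_desc.2 ⟨hu1, anc_linear l hv.2 hu.2 hvu⟩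
  · have h1 : v ∈ desc l u := mem_desc.2 ⟨hv1, anc_linear l hu.2 hv.2 hvu⟩
    by_cases huv : v = u
    · rw [← huv]; exact self_mem_desc hv1
    · exact absurd (desc_card_lt h1 huv) (by omega)

lemma desc_snoc_of_mem {l : List ℕ} {x v : ℕ} (hx : x ∈ desc l v) :
    desc (l ++ [x]) v = insert (l.length + 1) (desc l v) := by
  have hx' := mem_desc.1 hx
  ext u
  rw [Finset.mem_insert, mem_desc, mem_desc]
  simp only [List.length_append, List.length_singleton]
  by_cases hu : u = l.length + 1
  · subst hu
    simp [anc_snoc_last l hx'.1, hx'.2]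
  · constructor
    · rintro ⟨h1, h2⟩
      have h3 : u ≤ l.length := by omega
      rw [anc_snoc_of_le _ _ h3] at h2
      exact Or.inr ⟨h3, h2⟩
    · rintro (h1 | ⟨h1, h2⟩)
      · exact absurd h1 hu
      · exact ⟨by omega, by rwa [anc_snoc_of_le _ _ h1]⟩

lemma desc_snoc_of_notMem {l : List ℕ} {x v : ℕ} (hv : v ≤ l.length) (hxl : x ≤ l.length)
    (hx : x ∉ desc l v) : desc (l ++ [x]) v = desc l v := by
  ext u
  rw [mem_desc, mem_desc]
  simp only [List.length_append, List.length_singleton]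
  by_cases hu : u = l.length + 1
  · subst hu
    have : v ∉ anc l x := fun h => hx (mem_desc.2 ⟨hxl, h⟩)
    simp [anc_snoc_last l hxl, this]
    omega
  · constructor
    · rintro ⟨h1, h2⟩
      have h3 : u ≤ l.length := by omega
      rw [anc_snoc_of_le _ _ h3] at h2
      exact ⟨h3, h2⟩
    · rintro ⟨h1, h2⟩
      exact ⟨by omega, by rwa [anc_snoc_of_le _ _ h1]⟩

lemma desc_snoc_last {l : List ℕ} {x : ℕ} :
    desc (l ++ [x]) (l.length + 1) = {l.length + 1} := by
  ext u
  rw [mem_desc, Finset.mem_singleton]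
  simp only [List.length_append, List.length_singleton]
  constructor
  · rintro ⟨h1, h2⟩
    exact le_antisymm h1 (le_of_mem_anc _ h2)
  · rintro rfl
    exact ⟨le_rfl, mem_anc_self _ _⟩

lemma length_succ_notMem_desc {l : List ℕ} {v : ℕ} : l.length + 1 ∉ desc l v := by
  rw [mem_desc]; omega

lemma card_desc_snoc {l : List ℕ} {x v : ℕ} (hv : v ≤ l.length) (hxl : x ≤ l.length) :
    (desc (l ++ [x]) v).card = (desc l v).card + if x ∈ desc l v then 1 else 0 := by
  split_ifs with h
  · rw [desc_snoc_of_mem h, Finset.card_insert_of_notMem length_succ_notMem_desc]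
  · rw [desc_snoc_of_notMem hv hxl h, add_zero]

lemma card_desc_pos {l : List ℕ} {v : ℕ} (hv : v ≤ l.length) : 1 ≤ (desc l v).card :=
  Finset.card_pos.2 ⟨v, self_mem_desc hv⟩

lemma Reach.sum_weight_desc {χ ρ : ℝ} {l : List ℕ} (hl : Reach χ ρ l) {v : ℕ}
    (hv : v ≤ l.length) :
    ∑ u ∈ desc l v, (χ * (l.count u : ℝ) + ρ) = (χ + ρ) * (desc l v).card - χ := by
  induction hl generalizing v with
  | nil =>
    have hv : v = 0 := by simpa using hv
    subst hv
    have : desc [] 0 = {0} := by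
      ext u
      rw [mem_desc, Finset.mem_singleton]
      simp only [List.length_nil, Nat.le_zero]
      exact ⟨fun h => h.1, fun h => by subst h; exact ⟨rfl, mem_anc_self _ _⟩⟩
    simp [this]
  | @snoc l x hl hx hw ih =>
    have hnew : l.count (l.length + 1) = 0 :=
      List.count_eq_zero.2 fun h => by have := hl.le_length _ h; omega
    by_cases hv' : v = l.length + 1
    · subst hv'
      rw [desc_snoc_last]
      have : l.length + 1 ≠ x := by omega
      simp [List.count_append, hnew, Ne.symm this]
    · have hv1 : v ≤ l.length := by simp at hv; omega
      have hsum : ∀ s : Finset ℕ, ∑ u ∈ s, (χ * ((l ++ [x]).count u : ℝ) + ρ)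
          = ∑ u ∈ s, (χ * (l.count u : ℝ) + ρ) + if x ∈ s then χ else 0 := by
        intro s
        rw [← Finset.sum_ite_eq s x (fun _ => χ), ← Finset.sum_add_distrib]
        refine Finset.sum_congr rfl fun u _ => ?_
        rw [List.count_append, List.count_singleton]
        by_cases hux : x = u
        · simp [hux]; ring
        · simp [hux]
      rw [hsum]
      by_cases h : x ∈ desc l v
      · rw [desc_snoc_of_mem h, Finset.sum_insert length_succ_notMem_desc, ih hv1,
          Finset.card_insert_of_notMem length_succ_notMem_desc, hnew,
          if_pos (Finset.mem_insert_of_mem h)]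
        push_cast; ring
      · rw [desc_snoc_of_notMem hv1 hx h, ih hv1, if_neg h, add_zero]

end Trees
end PATpaper

namespace PATpaper

/-- The number of nodes of the fringe subtrees with `j` nodes, as a real number. -/
noncomputable def sizeCount (l : List ℕ) (j : ℕ) : ℝ :=
  ∑ v ∈ Finset.range (l.length + 1), if (desc l v).card = j then 1 else 0

/-- The number of fringe subtrees with `j` nodes that contain `x`; by convention it is `1`
for `j = 0`. -/
noncomputable def hits (l : List ℕ) (j x : ℕ) : ℝ :=
  if j = 0 then 1
  else ∑ v ∈ Finset.range (l.length + 1), if x ∈ desc l v ∧ (desc l v).card = j then 1 else 0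

/-- The number of pairs of a fringe subtree with `j` nodes and a fringe subtree with `i` nodes
inside it. -/
noncomputable def pairCount (l : List ℕ) (i j : ℕ) : ℝ :=
  ∑ v ∈ Finset.range (l.length + 1), ∑ u ∈ desc l v,
    if (desc l u).card = i ∧ (desc l v).card = j then 1 else 0

section Counts

lemma mem_range_succ {N v : ℕ} (h : v ∈ Finset.range (N + 1)) : v ≤ N :=
  Nat.lt_succ_iff.1 (Finset.mem_range.1 h)

lemma sum_containing_le_one (l : List ℕ) (j x : ℕ) :
    ∑ v ∈ Finset.range (l.length + 1),
      (if x ∈ desc l v ∧ (desc l v).card = j then 1 else 0 : ℝ) ≤ 1 := by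
  rw [← Finset.sum_filter, Finset.sum_const, nsmul_eq_mul, mul_one]
  norm_cast
  refine Finset.card_le_one.2 fun v hv w hw => ?_
  simp only [Finset.mem_filter] at hv hw
  by_contra hvw
  have h1 := desc_nested hv.2.1 hw.2.1 (by rw [hv.2.2, hw.2.2])
  have := desc_card_lt h1 hvw
  omega

lemma sum_containing_nonneg (l : List ℕ) (j x : ℕ) :
    0 ≤ ∑ v ∈ Finset.range (l.length + 1),
      (if x ∈ desc l v ∧ (desc l v).card = j then 1 else 0 : ℝ) :=
  Finset.sum_nonneg fun v _ => by split_ifs <;> norm_num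

lemma hits_le_one (l : List ℕ) (j x : ℕ) : hits l j x ≤ 1 := by
  unfold hits
  split_ifs
  · exact le_rfl
  · exact sum_containing_le_one l j x

lemma hits_nonneg (l : List ℕ) (j x : ℕ) : 0 ≤ hits l j x := by
  unfold hits
  split_ifs
  · norm_num
  · exact sum_containing_nonneg l j x

lemma hits_eq_zero_or_one (l : List ℕ) (j x : ℕ) : hits l j x = 0 ∨ hits l j x = 1 := by
  have h1 := hits_le_one l j x
  have h0 := hits_nonneg l j x
  obtain ⟨m, hm⟩ : ∃ m : ℕ, hits l j x = m := by
    unfold hits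
    split_ifs
    · exact ⟨1, by simp⟩
    · exact ⟨_, by rw [← Finset.sum_filter, Finset.sum_const, nsmul_eq_mul, mul_one]⟩
  rw [hm] at h1 h0 ⊢
  have : m ≤ 1 := by exact_mod_cast h1
  interval_cases m <;> simp

lemma length_snoc_add_one (l : List ℕ) (x : ℕ) :
    (l ++ [x]).length + 1 = l.length + 1 + 1 := by simp

lemma sizeCount_snoc {l : List ℕ} {x : ℕ} (hx : x ≤ l.length) (j : ℕ) :
    sizeCount (l ++ [x]) (j + 1) = sizeCount l (j + 1) + (hits l j x - hits l (j + 1) x) := by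
  have hj : hits l j x = (∑ v ∈ Finset.range (l.length + 1),
      if x ∈ desc l v ∧ (desc l v).card = j then 1 else 0) + if j = 0 then 1 else 0 := by
    unfold hits
    split_ifs with h0
    · rw [Finset.sum_eq_zero, zero_add]
      intro v hv
      have := card_desc_pos (mem_range_succ hv)
      rw [if_neg]; omega
    · rw [add_zero]
  have hj1 : hits l (j + 1) x = ∑ v ∈ Finset.range (l.length + 1),
      if x ∈ desc l v ∧ (desc l v).card = j + 1 then 1 else 0 := by
    rw [hits, if_neg (Nat.succ_ne_zero j)]
  rw [hj, hj1]
  unfold sizeCount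
  rw [length_snoc_add_one, Finset.sum_range_succ, desc_snoc_last, Finset.card_singleton]
  have h1 : (if 1 = j + 1 then (1 : ℝ) else 0) = if j = 0 then 1 else 0 := by
    congr 1; simp
  rw [h1, add_sub_right_comm, ← add_assoc, ← Finset.sum_sub_distrib, ← Finset.sum_add_distrib]
  congr 1
  refine Finset.sum_congr rfl fun v hv => ?_
  rw [card_desc_snoc (mem_range_succ hv) hx]
  by_cases h : x ∈ desc l v <;> simp [h]

lemma hits_mul_hits {l : List ℕ} {x i j : ℕ} (hi : 1 ≤ i) (hij : i ≤ j) :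
    hits l i x * hits l j x = ∑ v ∈ Finset.range (l.length + 1), ∑ u ∈ desc l v,
      if (desc l u).card = i ∧ (desc l v).card = j then
        (if x ∈ desc l u then 1 else 0) else 0 := by
  rw [hits, hits, if_neg (by omega), if_neg (by omega), mul_comm, Finset.sum_mul_sum]
  refine Finset.sum_congr rfl fun v hv => ?_
  have hsub : desc l v ⊆ Finset.range (l.length + 1) := fun u hu =>
    Finset.mem_range.2 (Nat.lt_succ_iff.2 (mem_desc.1 hu).1)
  rw [← Finset.sum_subset hsub]
  · refine Finset.sum_congr rfl fun u hu => ?_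
    have := desc_subset hu
    by_cases h : x ∈ desc l u
    · have h2 := this h
      by_cases h3 : (desc l u).card = i <;> by_cases h4 : (desc l v).card = j <;> simp [*]
    · simp [h]
  · intro u hu huv
    by_cases h : (x ∈ desc l v ∧ (desc l v).card = j) ∧ x ∈ desc l u ∧ (desc l u).card = i
    · exact absurd (desc_nested h.2.1 h.1.1 (by omega)) huv
    · rw [not_and_or] at h
      rcases h with h | h <;> simp [h]

lemma pairCount_snoc {l : List ℕ} {x : ℕ} (hx : x ≤ l.length) (i j : ℕ) :
    pairCount (l ++ [x]) i j =
      (∑ v ∈ Finset.range (l.length + 1), ∑ u ∈ desc l v,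
        if (desc l u).card + (if x ∈ desc l u then 1 else 0) = i ∧
          (desc l v).card + (if x ∈ desc l v then 1 else 0) = j then 1 else 0)
      + (∑ v ∈ Finset.range (l.length + 1), if x ∈ desc l v then
          (if 1 = i ∧ (desc l v).card + 1 = j then 1 else 0) else 0)
      + if 1 = i ∧ 1 = j then 1 else 0 := by
  unfold pairCount
  rw [length_snoc_add_one, Finset.sum_range_succ, desc_snoc_last, Finset.sum_singleton,
    desc_snoc_last, Finset.card_singleton, ← Finset.sum_add_distrib]
  congr 1
  refine Finset.sum_congr rfl fun v hv => ?_
  have hv := mem_range_succ hv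
  have hcongr : ∑ u ∈ desc l v, (if (desc (l ++ [x]) u).card = i ∧
        (desc (l ++ [x]) v).card = j then (1 : ℝ) else 0)
      = ∑ u ∈ desc l v, if (desc l u).card + (if x ∈ desc l u then 1 else 0) = i ∧
          (desc l v).card + (if x ∈ desc l v then 1 else 0) = j then 1 else 0 := by
    refine Finset.sum_congr rfl fun u hu => ?_
    rw [card_desc_snoc hv hx, card_desc_snoc (mem_desc.1 hu).1 hx]
  rw [← hcongr]
  by_cases h : x ∈ desc l v
  · rw [if_pos h, desc_snoc_of_mem h, Finset.sum_insert length_succ_notMem_desc, desc_snoc_last,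
      Finset.card_singleton, Finset.card_insert_of_notMem length_succ_notMem_desc, add_comm]
  · rw [if_neg h, add_zero]
    conv_lhs => rw [desc_snoc_of_notMem hv hx h]
    conv_rhs => rw [desc_snoc_of_notMem hv hx h]

lemma abs_pairCount_snoc_sub_le {l : List ℕ} {x : ℕ} (hx : x ≤ l.length) (i j : ℕ) :
    |pairCount (l ++ [x]) i (j + 1) - pairCount l i (j + 1)| ≤ 2 * j + 4 := by
  rw [pairCount_snoc hx, pairCount, add_assoc, add_sub_right_comm, ← Finset.sum_sub_distrib]
  simp_rw [← Finset.sum_sub_distrib]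
  set c : ℕ → ℕ → ℝ := fun a v => if x ∈ desc l v ∧ (desc l v).card = a then 1 else 0 with hc
  have hc0 : ∀ a v, 0 ≤ c a v := fun a v => by simp only [hc]; split_ifs <;> norm_num
  have h1 : |∑ v ∈ Finset.range (l.length + 1), ∑ u ∈ desc l v,
      ((if (desc l u).card + (if x ∈ desc l u then 1 else 0) = i ∧
          (desc l v).card + (if x ∈ desc l v then 1 else 0) = j + 1 then (1 : ℝ) else 0)
        - if (desc l u).card = i ∧ (desc l v).card = j + 1 then 1 else 0)|
      ≤ (j + 1) * (1 + 1) := by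
    calc _ ≤ ∑ v ∈ Finset.range (l.length + 1), ((j : ℝ) + 1) * (c j v + c (j + 1) v) := by
          refine (Finset.abs_sum_le_sum_abs _ _).trans (Finset.sum_le_sum fun v hv => ?_)
          by_cases h : x ∈ desc l v ∧ ((desc l v).card = j ∨ (desc l v).card = j + 1)
          · have hle : (1 : ℝ) ≤ c j v + c (j + 1) v := by
              rcases h.2 with h2 | h2
              · have : c j v = 1 := if_pos ⟨h.1, h2⟩
                have := hc0 (j + 1) v
                linarith
              · have : c (j + 1) v = 1 := if_pos ⟨h.1, h2⟩
                have := hc0 j v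
                linarith
            calc _ ≤ ∑ u ∈ desc l v, (1 : ℝ) := by
                  refine (Finset.abs_sum_le_sum_abs _ _).trans (Finset.sum_le_sum fun u _ => ?_)
                  split_ifs <;> simp
              _ = ((desc l v).card : ℝ) := by simp
              _ ≤ (j : ℝ) + 1 := by
                  have : (desc l v).card ≤ j + 1 := by omega
                  exact_mod_cast this
              _ ≤ _ := le_mul_of_one_le_right (by positivity) hle
          · rw [Finset.sum_eq_zero, abs_zero]
            · exact mul_nonneg (by positivity) (add_nonneg (hc0 _ _) (hc0 _ _))
            · intro u hu
              by_cases hxv : x ∈ desc l v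
              · have h2 : ¬ ((desc l v).card = j ∨ (desc l v).card = j + 1) :=
                  fun h3 => h ⟨hxv, h3⟩
                rw [if_neg, if_neg, sub_zero]
                · omega
                · rw [if_pos hxv]; omega
              · have hxu : x ∉ desc l u := fun h3 => hxv (desc_subset hu h3)
                simp [hxv, hxu]
      _ ≤ _ := by
          rw [← Finset.mul_sum, Finset.sum_add_distrib]
          exact mul_le_mul_of_nonneg_left (add_le_add (sum_containing_le_one l j x)
            (sum_containing_le_one l (j + 1) x)) (by positivity)
  have h2 : |∑ v ∈ Finset.range (l.length + 1), if x ∈ desc l v then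
          (if 1 = i ∧ (desc l v).card + 1 = j + 1 then (1 : ℝ) else 0) else 0| ≤ 1 := by
    calc _ ≤ ∑ v ∈ Finset.range (l.length + 1), c j v := by
          refine (Finset.abs_sum_le_sum_abs _ _).trans (Finset.sum_le_sum fun v _ => ?_)
          by_cases h3 : x ∈ desc l v
          · by_cases h4 : (desc l v).card = j
            · simp only [hc, h3, h4, and_self, if_true]
              split_ifs <;> simp
            · simp [h4, hc]
          · simp [h3, hc]
      _ ≤ 1 := sum_containing_le_one l j x
  have h3 : |(if 1 = i ∧ 1 = j + 1 then (1 : ℝ) else 0)| ≤ 1 := by split_ifs <;> simp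
  calc _ ≤ _ := (abs_add_le _ _).trans (add_le_add h1 ((abs_add_le _ _).trans (add_le_add h2 h3)))
    _ = _ := by ring

end Counts
end PATpaper

namespace PATpaper

/-- The parameter `κ = w_0 / w_1`. -/
noncomputable def kap (χ ρ : ℝ) : ℝ := ρ / (χ + ρ)

section Averages
variable {χ ρ : ℝ}

lemma Admissible.kap_pos (h : Admissible χ ρ) : 0 < kap χ ρ := div_pos h.pos h.add_pos

lemma Admissible.length_add_kap_pos (h : Admissible χ ρ) (n : ℕ) : 0 < (n : ℝ) + kap χ ρ :=
  add_pos_of_nonneg_of_pos n.cast_nonneg h.kap_pos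

lemma Reach.avg_mem_desc (h : Admissible χ ρ) {l : List ℕ} (hl : Reach χ ρ l) {v : ℕ}
    (hv : v ≤ l.length) :
    avg χ ρ l (fun x => if x ∈ desc l v then (1 : ℝ) else 0)
      = ((desc l v).card + kap χ ρ - 1) / (l.length + kap χ ρ) := by
  have hsub : desc l v ⊆ Finset.range (l.length + 1) := fun u hu =>
    Finset.mem_range.2 (Nat.lt_succ_iff.2 (mem_desc.1 hu).1)
  have h1 : avg χ ρ l (fun x => if x ∈ desc l v then (1 : ℝ) else 0)
      = ∑ u ∈ desc l v, attachProb χ ρ l u := by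
    unfold avg
    rw [← Finset.sum_subset hsub]
    · exact Finset.sum_congr rfl fun u hu => by simp [hu]
    · exact fun u _ hu => by simp [hu]
  rw [h1]
  simp only [attachProb]
  rw [← Finset.sum_div, hl.sum_weight_desc hv, div_eq_div_iff (h.total_pos _).ne'
    (h.length_add_kap_pos _).ne', kap]
  have := h.add_pos.ne'
  field_simp
  ring

lemma Reach.avg_hits (h : Admissible χ ρ) {l : List ℕ} (hl : Reach χ ρ l) {j : ℕ} (hj : 1 ≤ j) :
    avg χ ρ l (hits l j) = (j + kap χ ρ - 1) / (l.length + kap χ ρ) * sizeCount l j := by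
  have h1 : hits l j = fun x => ∑ v ∈ Finset.range (l.length + 1),
      (if (desc l v).card = j then (1 : ℝ) else 0) * if x ∈ desc l v then (1 : ℝ) else 0 := by
    funext x
    rw [hits, if_neg (by omega)]
    refine Finset.sum_congr rfl fun v _ => ?_
    by_cases h : x ∈ desc l v <;> simp [h]
  rw [h1, avg_sum, sizeCount, Finset.mul_sum]
  refine Finset.sum_congr rfl fun v hv => ?_
  rw [avg_const_mul, hl.avg_mem_desc h (mem_range_succ hv)]
  split_ifs with h2
  · rw [h2]; ring
  · ring

lemma Reach.avg_hits_zero (h : Admissible χ ρ) {l : List ℕ} (hl : Reach χ ρ l) :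
    avg χ ρ l (hits l 0) = 1 := by
  have : hits l 0 = fun _ => (1 : ℝ) := by funext x; simp [hits]
  rw [this, hl.avg_const h]

lemma Reach.avg_hits_mul_hits (h : Admissible χ ρ) {l : List ℕ} (hl : Reach χ ρ l) {i j : ℕ}
    (hi : 1 ≤ i) (hij : i ≤ j) :
    avg χ ρ l (fun x => hits l i x * hits l j x)
      = (i + kap χ ρ - 1) / (l.length + kap χ ρ) * pairCount l i j := by
  have h1 : (fun x => hits l i x * hits l j x) = fun x => ∑ v ∈ Finset.range (l.length + 1),
      ∑ u ∈ desc l v, (if (desc l u).card = i ∧ (desc l v).card = j then (1 : ℝ) else 0) *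
        (if x ∈ desc l u then 1 else 0) := by
    funext x
    rw [hits_mul_hits hi hij]
    refine Finset.sum_congr rfl fun v _ => Finset.sum_congr rfl fun u _ => ?_
    split_ifs <;> simp
  rw [h1, avg_sum, pairCount, Finset.mul_sum]
  refine Finset.sum_congr rfl fun v _ => ?_
  rw [avg_sum, Finset.mul_sum]
  refine Finset.sum_congr rfl fun u hu => ?_
  rw [avg_const_mul, hl.avg_mem_desc h (mem_desc.1 hu).1]
  split_ifs with h2
  · rw [h2.1]; ring
  · ring

lemma avg_hits_zero_mul_hits {l : List ℕ} (j : ℕ) :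
    avg χ ρ l (fun x => hits l 0 x * hits l j x) = avg χ ρ l (hits l j) := by
  congr 1
  funext x
  simp [hits]

lemma Reach.avg_sizeCount_snoc (h : Admissible χ ρ) {l : List ℕ} (hl : Reach χ ρ l) (j : ℕ) :
    avg χ ρ l (fun x => sizeCount (l ++ [x]) (j + 1))
      = sizeCount l (j + 1) + (avg χ ρ l (hits l j) - avg χ ρ l (hits l (j + 1))) := by
  rw [hl.avg_congr h (fun x hx _ => sizeCount_snoc hx j), avg_add, hl.avg_const h, avg_sub]

lemma Reach.avg_pairCount_snoc (h : Admissible χ ρ) {l : List ℕ} (hl : Reach χ ρ l) (i j : ℕ) :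
    avg χ ρ l (fun x => pairCount (l ++ [x]) (i + 1) (j + 1))
      = (1 - (j + kap χ ρ) / (l.length + kap χ ρ)) * pairCount l (i + 1) (j + 1)
        + ((i + kap χ ρ - 1) * pairCount l i j + (j - i - 1) * pairCount l (i + 1) j
          + if i = 0 then (j + kap χ ρ - 1) * sizeCount l j
              + (if j = 0 then l.length + kap χ ρ else 0) else 0) / (l.length + kap χ ρ) := by
  rw [hl.avg_congr h (fun x hx _ => pairCount_snoc hx (i + 1) (j + 1)), avg_add, avg_add,
    hl.avg_const h]
  set g : ℕ → ℕ → ℝ := fun a b => if a = i + 1 ∧ b = j + 1 then 1 else 0 with hg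
  have hpos := (h.length_add_kap_pos l.length).ne'
  have h1 : avg χ ρ l (fun x => ∑ v ∈ Finset.range (l.length + 1), ∑ u ∈ desc l v,
        if (desc l u).card + (if x ∈ desc l u then 1 else 0) = i + 1 ∧
          (desc l v).card + (if x ∈ desc l v then 1 else 0) = j + 1 then (1 : ℝ) else 0)
      = (1 - (j + kap χ ρ) / (l.length + kap χ ρ)) * pairCount l (i + 1) (j + 1)
        + ((i + kap χ ρ - 1) * pairCount l i j + (j - i - 1) * pairCount l (i + 1) j)
          / (l.length + kap χ ρ) := by
    rw [avg_sum]
    simp only [pairCount]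
    rw [Finset.mul_sum, Finset.mul_sum, Finset.mul_sum, ← Finset.sum_add_distrib, Finset.sum_div,
      ← Finset.sum_add_distrib]
    refine Finset.sum_congr rfl fun v hv => ?_
    have hv := mem_range_succ hv
    rw [avg_sum, Finset.mul_sum, Finset.mul_sum, Finset.mul_sum, ← Finset.sum_add_distrib,
      Finset.sum_div, ← Finset.sum_add_distrib]
    refine Finset.sum_congr rfl fun u hu => ?_
    set s := (desc l u).card with hs
    set t := (desc l v).card with ht
    have h2 : ∀ x, (if s + (if x ∈ desc l u then 1 else 0) = i + 1 ∧
          t + (if x ∈ desc l v then 1 else 0) = j + 1 then (1 : ℝ) else 0)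
        = (g (s + 1) (t + 1) - g s (t + 1)) * (if x ∈ desc l u then 1 else 0)
          + (g s (t + 1) - g s t) * (if x ∈ desc l v then 1 else 0) + g s t := by
      intro x
      by_cases hxv : x ∈ desc l v
      · by_cases hxu : x ∈ desc l u <;> simp [hxu, hxv, hg]
      · have hxu : x ∉ desc l u := fun h3 => hxv (desc_subset hu h3)
        simp [hxu, hxv, hg]
    simp_rw [h2]
    rw [avg_add, avg_add, hl.avg_const h, avg_const_mul, avg_const_mul,
      hl.avg_mem_desc h (mem_desc.1 hu).1, hl.avg_mem_desc h hv, ← hs, ← ht]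
    simp only [hg, add_left_inj]
    by_cases hsi : s = i + 1
    · have hsi' : ¬ s = i := by omega
      by_cases htj : t = j + 1
      · have htj' : ¬ t = j := by omega
        simp [hsi, htj]
        field_simp
        ring
      · by_cases htj2 : t = j
        · simp [hsi, htj2]
          field_simp
          ring
        · simp [htj, htj2]
    · by_cases hsi2 : s = i
      · by_cases htj2 : t = j
        · simp [hsi2, htj2]
        · simp [hsi2, htj2]
      · simp [hsi, hsi2]
  have h2 : avg χ ρ l (fun x => ∑ v ∈ Finset.range (l.length + 1), if x ∈ desc l v then
          (if 1 = i + 1 ∧ (desc l v).card + 1 = j + 1 then (1 : ℝ) else 0) else 0)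
      = (if i = 0 then (j + kap χ ρ - 1) * sizeCount l j else 0) / (l.length + kap χ ρ) := by
    rw [avg_sum]
    by_cases hi : i = 0
    · rw [if_pos hi, sizeCount, Finset.mul_sum, Finset.sum_div]
      refine Finset.sum_congr rfl fun v hv => ?_
      have h3 : ∀ x, (if x ∈ desc l v then
          (if 1 = i + 1 ∧ (desc l v).card + 1 = j + 1 then (1 : ℝ) else 0) else 0)
          = (if (desc l v).card = j then 1 else 0) * (if x ∈ desc l v then 1 else 0) := by
        intro x
        by_cases hx : x ∈ desc l v <;> simp [hx, hi]
      simp_rw [h3]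
      rw [avg_const_mul, hl.avg_mem_desc h (mem_range_succ hv)]
      split_ifs with h4
      · rw [h4]; ring
      · ring
    · rw [if_neg hi, zero_div]
      refine Finset.sum_eq_zero fun v _ => ?_
      have h3 : ∀ x, (if x ∈ desc l v then
          (if 1 = i + 1 ∧ (desc l v).card + 1 = j + 1 then (1 : ℝ) else 0) else 0) = 0 := by
        intro x
        rw [if_neg (by omega : ¬ (1 = i + 1 ∧ (desc l v).card + 1 = j + 1)), ite_self]
      simp_rw [h3]
      exact hl.avg_const h 0
  rw [h1, h2]
  by_cases hi : i = 0
  · by_cases hj : j = 0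
    · simp [hi, hj]; field_simp; ring
    · have : ¬ (1 = j + 1) := by omega
      simp [hi, hj]; field_simp; ring
  · simp [hi]

end Averages
end PATpaper

namespace PATpaper
open Filter Topology

/-- Convergence in mean of a functional of the tree with `n` nodes to a constant. -/
def ConvL1 (χ ρ : ℝ) (F : List ℕ → ℝ) (c : ℝ) : Prop :=
  Tendsto (fun n => ex χ ρ n (fun l => |F l - c|)) atTop (𝓝 0)

section LawOfLargeNumbers
variable {χ ρ : ℝ}

lemma ConvL1.of_le (h : Admissible χ ρ) {F : List ℕ → ℝ} {c : ℝ} {G : List ℕ → ℝ}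
    (hG : Tendsto (fun n => ex χ ρ n G) atTop (𝓝 0))
    (hFG : ∀ l, Reach χ ρ l → |F l - c| ≤ G l) : ConvL1 χ ρ F c := by
  refine tendsto_of_tendsto_of_tendsto_of_le_of_le' tendsto_const_nhds hG ?_ ?_
  · filter_upwards [eventually_ge_atTop 1] with n hn
    exact ex_nonneg h hn fun l _ _ => abs_nonneg _
  · filter_upwards [eventually_ge_atTop 1] with n hn
    exact ex_mono h hn fun l hl _ => hFG l hl

lemma ConvL1.congr (h : Admissible χ ρ) {F G : List ℕ → ℝ} {c : ℝ} (hF : ConvL1 χ ρ F c)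
    (hFG : ∀ l, Reach χ ρ l → F l = G l) : ConvL1 χ ρ G c :=
  ConvL1.of_le h hF fun l hl => by rw [hFG l hl]

lemma ConvL1.of_tendsto (h : Admissible χ ρ) {a : ℕ → ℝ} {c : ℝ} (ha : Tendsto a atTop (𝓝 c)) :
    ConvL1 χ ρ (fun l => a (l.length + 1)) c := by
  have h1 : Tendsto (fun n => |a n - c|) atTop (𝓝 0) := by
    have := (ha.sub_const c).abs
    simpa using this
  refine h1.congr' ?_
  filter_upwards [eventually_ge_atTop 1] with n hn
  rw [← ex_const h hn (|a n - c|)]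
  exact ex_congr h hn fun l _ hl => by rw [hl]

lemma ConvL1.const (h : Admissible χ ρ) (c : ℝ) : ConvL1 χ ρ (fun _ => c) c :=
  ConvL1.of_tendsto h (a := fun _ => c) tendsto_const_nhds

lemma ConvL1.add (h : Admissible χ ρ) {F G : List ℕ → ℝ} {c d : ℝ} (hF : ConvL1 χ ρ F c)
    (hG : ConvL1 χ ρ G d) : ConvL1 χ ρ (fun l => F l + G l) (c + d) := by
  refine ConvL1.of_le h (G := fun l => |F l - c| + |G l - d|) ?_ fun l _ => ?_
  · have h1 := Tendsto.add hF hG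
    simp only [add_zero] at h1
    exact h1.congr fun n => (ex_add n _ _).symm
  · rw [add_sub_add_comm]; exact abs_add_le _ _

lemma ConvL1.mul (h : Admissible χ ρ) {F G : List ℕ → ℝ} {c d B : ℝ} (hF : ConvL1 χ ρ F c)
    (hG : ConvL1 χ ρ G d) (hB : ∀ l, Reach χ ρ l → |F l| ≤ B) :
    ConvL1 χ ρ (fun l => F l * G l) (c * d) := by
  refine ConvL1.of_le h (G := fun l => B * |G l - d| + |d| * |F l - c|) ?_ fun l hl => ?_
  · have h1 := (Tendsto.const_mul B hG).add (Tendsto.const_mul |d| hF)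
    simp only [mul_zero, add_zero] at h1
    refine h1.congr fun n => ?_
    rw [ex_add, ex_const_mul, ex_const_mul]
  · have : F l * G l - c * d = F l * (G l - d) + d * (F l - c) := by ring
    rw [this]
    refine (abs_add_le _ _).trans ?_
    rw [abs_mul, abs_mul]
    exact add_le_add (mul_le_mul_of_nonneg_right (hB l hl) (abs_nonneg _)) le_rfl

lemma ConvL1.const_mul (h : Admissible χ ρ) {F : List ℕ → ℝ} {c : ℝ} (a : ℝ)
    (hF : ConvL1 χ ρ F c) : ConvL1 χ ρ (fun l => a * F l) (a * c) :=
  (ConvL1.const h a).mul h hF fun _ _ => le_rfl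

lemma ConvL1.sub (h : Admissible χ ρ) {F G : List ℕ → ℝ} {c d : ℝ} (hF : ConvL1 χ ρ F c)
    (hG : ConvL1 χ ρ G d) : ConvL1 χ ρ (fun l => F l - G l) (c - d) := by
  have := hF.add h (hG.const_mul h (-1))
  simpa [sub_eq_add_neg] using this

lemma ConvL1.nonneg (h : Admissible χ ρ) {F : List ℕ → ℝ} {c : ℝ} (hF : ConvL1 χ ρ F c)
    (h0 : ∀ l, Reach χ ρ l → 0 ≤ F l) : 0 ≤ c := by
  have : -c ≤ 0 := by
    refine ge_of_tendsto hF ?_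
    filter_upwards [eventually_ge_atTop 1] with n hn
    rw [← ex_const h hn (-c)]
    refine ex_mono h hn fun l hl _ => ?_
    have := h0 l hl
    have := le_abs_self (F l - c)
    linarith
  linarith

lemma tendsto_div_sq_of_le {V a : ℕ → ℝ} {C : ℝ} (hC : 0 ≤ C) (hV : ∀ n, 0 ≤ V n)
    (ha : Tendsto a atTop (𝓝 0))
    (hstep : ∀ n, 1 ≤ n → V (n + 1) ≤ V n + n * a n + C) :
    Tendsto (fun n => V n / (n : ℝ) ^ 2) atTop (𝓝 0) := by
  have hb : ∀ n, 1 ≤ n → V n ≤ V 1 + n * ∑ m ∈ Finset.range n, |a m| + C * n := by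
    intro n hn
    induction n, hn using Nat.le_induction with
    | base =>
      have : 0 ≤ |a 0| := abs_nonneg _
      simp; linarith
    | succ n hn ih =>
      have h1 := hstep n hn
      rw [Finset.sum_range_succ]
      push_cast
      have h2 : (n : ℝ) * a n ≤ n * |a n| := mul_le_mul_of_nonneg_left (le_abs_self _) n.cast_nonneg
      have h3 : 0 ≤ ∑ m ∈ Finset.range n, |a m| := Finset.sum_nonneg fun _ _ => abs_nonneg _
      have h4 : 0 ≤ |a n| := abs_nonneg _
      nlinarith
  have hlim : Tendsto (fun n : ℕ => V 1 * ((n : ℝ)⁻¹ * (n : ℝ)⁻¹)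
      + (n : ℝ)⁻¹ * ∑ m ∈ Finset.range n, |a m| + C * (n : ℝ)⁻¹) atTop (𝓝 0) := by
    have hinv : Tendsto (fun n : ℕ => (n : ℝ)⁻¹) atTop (𝓝 0) := tendsto_inv_atTop_nhds_zero_nat
    have hces := (by simpa using ha.abs : Tendsto (fun n => |a n|) atTop (𝓝 0)).cesaro
    have := (((hinv.mul hinv).const_mul (V 1)).add hces).add (hinv.const_mul C)
    simpa using this
  refine tendsto_of_tendsto_of_tendsto_of_le_of_le' tendsto_const_nhds hlim ?_ ?_
  · exact Eventually.of_forall fun n => div_nonneg (hV n) (sq_nonneg _)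
  · filter_upwards [eventually_ge_atTop 1] with n hn
    have hn' : (0 : ℝ) < n := by exact_mod_cast hn
    rw [div_le_iff₀ (by positivity)]
    refine (hb n hn).trans (le_of_eq ?_)
    field_simp

lemma Admissible.exists_length_le (h : Admissible χ ρ) :
    ∃ A : ℝ, 0 < A ∧ ∀ n : ℕ, (n : ℝ) + 1 ≤ A * (n + kap χ ρ) := by
  have hk := h.kap_pos
  refine ⟨1 + (kap χ ρ)⁻¹, by positivity, fun n => ?_⟩
  have h1 : (kap χ ρ)⁻¹ * kap χ ρ = 1 := inv_mul_cancel₀ hk.ne'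
  have h2 : 0 ≤ (kap χ ρ)⁻¹ * n := by positivity
  nlinarith

lemma abs_le_of_increments {F : List ℕ → ℝ} {C : ℝ}
    (hC : ∀ l x, Reach χ ρ l → x ≤ l.length → |F (l ++ [x]) - F l| ≤ C) {l : List ℕ}
    (hl : Reach χ ρ l) : |F l| ≤ |F []| + C * l.length := by
  induction hl with
  | nil => simp
  | @snoc l x hl hx hw ih =>
    have h1 := hC l x hl hx
    have h2 := abs_add_le (F (l ++ [x]) - F l) (F l)
    rw [sub_add_cancel] at h2
    simp only [List.length_append, List.length_singleton]
    push_cast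
    linarith

/-- The law of large numbers for functionals with bounded increments and linear drift. -/
lemma convL1_of_drift (h : Admissible χ ρ) {F R : List ℕ → ℝ} {lam r C : ℝ} (hlam : 0 ≤ lam)
    (hC : ∀ l x, Reach χ ρ l → x ≤ l.length → |F (l ++ [x]) - F l| ≤ C)
    (hF : ∀ l, Reach χ ρ l → avg χ ρ l (fun x => F (l ++ [x]))
      = (1 - lam / (l.length + kap χ ρ)) * F l + R l / (l.length + kap χ ρ))
    (hR : ConvL1 χ ρ (fun l => R l / (l.length + 1)) r) :
    ConvL1 χ ρ (fun l => F l / (l.length + 1)) (r / (1 + lam)) := by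
  set z := r / (1 + lam) with hz
  have hr : r = z * (1 + lam) := by rw [hz]; field_simp
  have hC0 : 0 ≤ C := (abs_nonneg _).trans (hC [] 0 Reach.nil (by simp))
  set D : List ℕ → ℝ := fun l => F l - z * (l.length + 1) with hD
  set B : ℝ := |F []| + C + |z| with hB
  have hB0 : 0 ≤ B := by positivity
  have hDB : ∀ l, Reach χ ρ l → |D l| ≤ B * (l.length + 1) := by
    intro l hl
    have h1 := abs_le_of_increments hC hl
    have h2 : |D l| ≤ |F l| + |z * (l.length + 1)| := abs_sub _ _
    have h3 : |z * ((l.length : ℝ) + 1)| = |z| * (l.length + 1) := by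
      rw [abs_mul, abs_of_nonneg (by positivity : (0 : ℝ) ≤ (l.length : ℝ) + 1)]
    have h4 : 0 ≤ |F []| * (l.length : ℝ) := by positivity
    rw [hB]; nlinarith
  obtain ⟨A, hA, hAn⟩ := h.exists_length_le
  set C3 : ℝ := 2 * (B * A) * |z * (1 - kap χ ρ)| + (C + |z|) ^ 2 with hC3
  have hstep : ∀ l, Reach χ ρ l → avg χ ρ l (fun x => D (l ++ [x]) ^ 2)
      ≤ D l ^ 2 + ((l.length : ℝ) + 1) * (2 * (B * A) * |R l / (l.length + 1) - r|) + C3 := by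
    intro l hl
    have hpos := h.length_add_kap_pos l.length
    have e1 : ∀ x, D (l ++ [x]) = D l + (F (l ++ [x]) - F l - z) := by
      intro x
      simp only [hD, List.length_append, List.length_singleton]
      push_cast; ring
    have e2 : avg χ ρ l (fun x => F (l ++ [x]) - F l - z)
        = (-lam * D l + (R l - r * (l.length + 1)) + z * (1 - kap χ ρ))
          / (l.length + kap χ ρ) := by
      rw [avg_sub, avg_sub, hl.avg_const h, hl.avg_const h, hF l hl, hr]
      simp only [hD]
      field_simp
      ring
    have e3 : avg χ ρ l (fun x => D (l ++ [x]) ^ 2)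
        ≤ D l ^ 2 + 2 * D l * avg χ ρ l (fun x => F (l ++ [x]) - F l - z) + (C + |z|) ^ 2 := by
      calc _ ≤ avg χ ρ l (fun x => D l ^ 2 + 2 * D l * (F (l ++ [x]) - F l - z)
              + (C + |z|) ^ 2) := by
            refine hl.avg_mono h fun x hx _ => ?_
            rw [e1]
            have h1 : |F (l ++ [x]) - F l - z| ≤ C + |z| :=
              (abs_sub _ _).trans (add_le_add (hC l x hl hx) le_rfl)
            have h2 := sq_le_sq' (abs_le.1 h1).1 (abs_le.1 h1).2
            nlinarith
        _ = _ := by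
            rw [avg_add, avg_add, hl.avg_const h, hl.avg_const h, avg_const_mul]
    have e4 : |D l| / (l.length + kap χ ρ) ≤ B * A := by
      rw [div_le_iff₀ hpos, mul_assoc]
      exact (hDB l hl).trans (mul_le_mul_of_nonneg_left (hAn _) hB0)
    have e5 : |R l - r * (l.length + 1)|
        = ((l.length : ℝ) + 1) * |R l / (l.length + 1) - r| := by
      have h1 : (0 : ℝ) < (l.length : ℝ) + 1 := by positivity
      rw [← abs_of_pos h1, ← abs_mul, abs_of_pos h1]
      congr 1
      field_simp
    have e6 : 2 * D l * avg χ ρ l (fun x => F (l ++ [x]) - F l - z)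
        ≤ 2 * (B * A) * (|R l - r * (l.length + 1)| + |z * (1 - kap χ ρ)|) := by
      rw [e2]
      set P := R l - r * (l.length + 1)
      set Q := z * (1 - kap χ ρ)
      have h1 : 2 * D l * ((-lam * D l + P + Q) / (l.length + kap χ ρ))
          = -(2 * lam * D l ^ 2 / (l.length + kap χ ρ))
            + 2 * (D l * (P + Q) / (l.length + kap χ ρ)) := by ring
      have h2 : 0 ≤ 2 * lam * D l ^ 2 / (l.length + kap χ ρ) := by positivity
      have h3 : D l * (P + Q) / (l.length + kap χ ρ) ≤ (B * A) * (|P| + |Q|) := by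
        calc _ ≤ |D l * (P + Q)| / (l.length + kap χ ρ) :=
              div_le_div_of_nonneg_right (le_abs_self _) hpos.le
          _ = |D l| / (l.length + kap χ ρ) * |P + Q| := by rw [abs_mul]; ring
          _ ≤ _ := mul_le_mul e4 (abs_add_le _ _) (abs_nonneg _) (by positivity)
      rw [h1]; linarith
    rw [e5] at e6
    rw [hC3]
    linarith
  have hV : Tendsto (fun n => ex χ ρ n (fun l => D l ^ 2) / (n : ℝ) ^ 2) atTop (𝓝 0) := by
    have ha := Tendsto.const_mul (2 * (B * A)) hR
    rw [mul_zero] at ha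
    refine (tendsto_div_sq_of_le (V := fun n => if n = 0 then 0 else ex χ ρ n (fun l => D l ^ 2))
      (C := C3) (by positivity) ?_ ha ?_).congr' ?_
    · intro n
      split_ifs with h0
      · exact le_rfl
      · exact ex_nonneg h (by omega) fun l _ _ => sq_nonneg _
    · intro n hn
      dsimp only
      rw [if_neg (by omega), if_neg (by omega), ex_succ hn, ← ex_const_mul, ← ex_const_mul,
        ← ex_add, ← ex_const h hn C3, ← ex_add]
      refine ex_mono h hn fun l hl hln => ?_
      have : (n : ℝ) = (l.length : ℝ) + 1 := by rw [← hln]; push_cast; ring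
      rw [this]
      exact hstep l hl
    · filter_upwards [eventually_ge_atTop 1] with n hn
      rw [if_neg (by omega)]
  have hs := hV.sqrt
  rw [Real.sqrt_zero] at hs
  refine tendsto_of_tendsto_of_tendsto_of_le_of_le' tendsto_const_nhds hs ?_ ?_
  · filter_upwards [eventually_ge_atTop 1] with n hn
    exact ex_nonneg h hn fun l _ _ => abs_nonneg _
  · filter_upwards [eventually_ge_atTop 1] with n hn
    refine (le_abs_self _).trans (Real.abs_le_sqrt ((sq_ex_abs_le h hn _).trans (le_of_eq ?_)))
    rw [div_eq_inv_mul, ← ex_const_mul]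
    refine ex_congr h hn fun l _ hln => ?_
    have : (n : ℝ) = (l.length : ℝ) + 1 := by rw [← hln]; push_cast; ring
    rw [this]
    simp only [hD]
    field_simp

end LawOfLargeNumbers
end PATpaper

namespace PATpaper
open Filter Topology

/-- The limiting proportion of fringe subtrees with `j + 1` nodes. -/
noncomputable def density (χ ρ : ℝ) (j : ℕ) : ℝ :=
  kap χ ρ / ((j + kap χ ρ) * (j + kap χ ρ + 1))

/-- The increment of the number of fringe subtrees with `j + 1` nodes when a child of `x` is
added. -/
noncomputable def sizeIncr (l : List ℕ) (j x : ℕ) : ℝ := hits l j x - hits l (j + 1) x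

/-- The conditional covariance of two increments. -/
noncomputable def condCov (χ ρ : ℝ) (l : List ℕ) (i j : ℕ) : ℝ :=
  avg χ ρ l (fun x => sizeIncr l i x * sizeIncr l j x)
    - avg χ ρ l (sizeIncr l i) * avg χ ρ l (sizeIncr l j)

section LimitConstants
variable {χ ρ : ℝ}

lemma abs_sizeIncr_le (l : List ℕ) (j x : ℕ) : |sizeIncr l j x| ≤ 1 := by
  have h1 := hits_le_one l j x
  have h2 := hits_nonneg l j x
  have h3 := hits_le_one l (j + 1) x
  have h4 := hits_nonneg l (j + 1) x
  unfold sizeIncr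
  rw [abs_le]; constructor <;> linarith

lemma sizeIncr_le_sq (l : List ℕ) (j x : ℕ) : sizeIncr l j x ≤ sizeIncr l j x * sizeIncr l j x := by
  unfold sizeIncr
  rcases hits_eq_zero_or_one l j x with h1 | h1 <;>
    rcases hits_eq_zero_or_one l (j + 1) x with h2 | h2 <;> rw [h1, h2] <;> norm_num

lemma tendsto_add_kap_div :
    Tendsto (fun n : ℕ => ((n : ℝ) - 1 + kap χ ρ) / n) atTop (𝓝 1) := by
  have h1 : Tendsto (fun n : ℕ => 1 + (kap χ ρ - 1) * (n : ℝ)⁻¹) atTop (𝓝 (1 + (kap χ ρ - 1) * 0)) :=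
    (tendsto_inv_atTop_nhds_zero_nat.const_mul _).const_add 1
  rw [mul_zero, add_zero] at h1
  refine h1.congr' ?_
  filter_upwards [eventually_ge_atTop 1] with n hn
  have : (n : ℝ) ≠ 0 := by positivity
  field_simp
  ring

lemma convL1_add_kap_div (h : Admissible χ ρ) :
    ConvL1 χ ρ (fun l => (l.length + kap χ ρ) / (l.length + 1)) 1 :=
  (ConvL1.of_tendsto h tendsto_add_kap_div).congr h fun l _ => by push_cast; ring

lemma convL1_div_add_kap (h : Admissible χ ρ) {F : List ℕ → ℝ} {c : ℝ}
    (hF : ConvL1 χ ρ (fun l => F l / (l.length + 1)) c) :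
    ConvL1 χ ρ (fun l => F l / (l.length + kap χ ρ)) c := by
  have h1 : ConvL1 χ ρ (fun l => ((l.length + kap χ ρ) / (l.length + 1) : ℝ)⁻¹) 1 := by
    have := (tendsto_add_kap_div (χ := χ) (ρ := ρ)).inv₀ one_ne_zero
    rw [inv_one] at this
    exact (ConvL1.of_tendsto h this).congr h fun l _ => by push_cast; ring
  obtain ⟨A, hA, hAn⟩ := h.exists_length_le
  have h2 := h1.mul h hF (B := A) fun l _ => by
    have hp := h.length_add_kap_pos l.length
    rw [inv_div, abs_of_nonneg (by positivity), div_le_iff₀ hp]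
    exact hAn _
  rw [one_mul] at h2
  refine h2.congr h fun l _ => ?_
  have hp := h.length_add_kap_pos l.length
  field_simp

lemma Reach.avg_sizeCount_snoc' (h : Admissible χ ρ) {l : List ℕ} (hl : Reach χ ρ l) (j : ℕ) :
    avg χ ρ l (fun x => sizeCount (l ++ [x]) (j + 1))
      = (1 - (j + kap χ ρ) / (l.length + kap χ ρ)) * sizeCount l (j + 1)
        + (if j = 0 then l.length + kap χ ρ else (j + kap χ ρ - 1) * sizeCount l j)
          / (l.length + kap χ ρ) := by
  have hp := h.length_add_kap_pos l.length
  rw [hl.avg_sizeCount_snoc h, hl.avg_hits h (by omega : 1 ≤ j + 1)]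
  split_ifs with h0
  · subst h0
    rw [hl.avg_hits_zero h]
    push_cast
    field_simp
    ring
  · rw [hl.avg_hits h (by omega)]
    push_cast
    field_simp
    ring

lemma convL1_sizeCount (h : Admissible χ ρ) (j : ℕ) :
    ConvL1 χ ρ (fun l => sizeCount l (j + 1) / (l.length + 1)) (density χ ρ j) := by
  have hk := h.kap_pos
  have hinc : ∀ j l x, Reach χ ρ l → x ≤ l.length →
      |sizeCount (l ++ [x]) (j + 1) - sizeCount l (j + 1)| ≤ 1 := by
    intro j l x _ hx
    rw [sizeCount_snoc hx, add_sub_cancel_left]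
    exact abs_sizeIncr_le l j x
  set R : ℕ → List ℕ → ℝ := fun j l =>
    if j = 0 then l.length + kap χ ρ else (j + kap χ ρ - 1) * sizeCount l j with hR
  have key : ∀ j r, ConvL1 χ ρ (fun l => R j l / (l.length + 1)) r →
      ConvL1 χ ρ (fun l => sizeCount l (j + 1) / (l.length + 1)) (r / (1 + (j + kap χ ρ))) :=
    fun j r hr => convL1_of_drift h (by positivity) (hinc j)
      (fun l hl => hl.avg_sizeCount_snoc' h j) hr
  induction j with
  | zero =>
    have := key 0 1 ((convL1_add_kap_div h).congr h fun l _ => by simp only [hR, if_pos])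
    convert this using 1
    unfold density
    push_cast
    field_simp
    ring
  | succ j ih =>
    have := key (j + 1) ((j + kap χ ρ) * density χ ρ j)
      ((ih.const_mul h (j + kap χ ρ)).congr h fun l _ => by
        simp only [hR]
        rw [if_neg (by omega)]
        push_cast
        ring)
    convert this using 1
    unfold density
    push_cast
    field_simp
    ring

lemma sizeCount_zero (l : List ℕ) : sizeCount l 0 = 0 :=
  Finset.sum_eq_zero fun _ hv => if_neg (Nat.pos_iff_ne_zero.1 (card_desc_pos (mem_range_succ hv)))

lemma pairCount_zero_right (l : List ℕ) (i : ℕ) : pairCount l i 0 = 0 :=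
  Finset.sum_eq_zero fun _ hv => Finset.sum_eq_zero fun _ _ =>
    if_neg fun hh => Nat.pos_iff_ne_zero.1 (card_desc_pos (mem_range_succ hv)) hh.2

lemma pairCount_zero_left (l : List ℕ) (j : ℕ) : pairCount l 0 j = 0 :=
  Finset.sum_eq_zero fun _ _ => Finset.sum_eq_zero fun _ hu =>
    if_neg fun hh => Nat.pos_iff_ne_zero.1 (card_desc_pos (mem_desc.1 hu).1) hh.1

lemma exists_convL1_sizeCount (h : Admissible χ ρ) (j : ℕ) :
    ∃ c, ConvL1 χ ρ (fun l => sizeCount l j / (l.length + 1)) c := by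
  cases j with
  | zero => exact ⟨0, (ConvL1.const h 0).congr h fun l _ => by rw [sizeCount_zero, zero_div]⟩
  | succ j => exact ⟨_, convL1_sizeCount h j⟩

lemma exists_convL1_pairCount (h : Admissible χ ρ) (j i : ℕ) :
    ∃ z, ConvL1 χ ρ (fun l => pairCount l i j / (l.length + 1)) z := by
  have hk := h.kap_pos
  induction j generalizing i with
  | zero =>
    exact ⟨0, (ConvL1.const h 0).congr h fun l _ => by rw [pairCount_zero_right, zero_div]⟩
  | succ j ih =>
    cases i with
    | zero =>
      exact ⟨0, (ConvL1.const h 0).congr h fun l _ => by rw [pairCount_zero_left, zero_div]⟩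
    | succ i =>
      obtain ⟨z1, h1⟩ := ih i
      obtain ⟨z2, h2⟩ := ih (i + 1)
      obtain ⟨c, h3⟩ := exists_convL1_sizeCount h j
      have h4 := convL1_add_kap_div h
      have h5 := ((h1.const_mul h (i + kap χ ρ - 1)).add h
        (h2.const_mul h ((j : ℝ) - i - 1))).add h
        (((h3.const_mul h (j + kap χ ρ - 1)).add h
          (h4.const_mul h (if j = 0 then 1 else 0))).const_mul h (if i = 0 then 1 else 0))
      exact ⟨_, convL1_of_drift h (lam := j + kap χ ρ) (by positivity)
        (fun l x _ hx => abs_pairCount_snoc_sub_le hx (i + 1) j)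
        (fun l hl => hl.avg_pairCount_snoc h i j)
        (h5.congr h fun l _ => by split_ifs <;> ring)⟩

lemma exists_convL1_avg_hits (h : Admissible χ ρ) (j : ℕ) :
    ∃ c, ConvL1 χ ρ (fun l => avg χ ρ l (hits l j)) c := by
  rcases Nat.eq_zero_or_pos j with rfl | hj
  · exact ⟨1, (ConvL1.const h 1).congr h fun l hl => (hl.avg_hits_zero h).symm⟩
  · obtain ⟨c, hc⟩ := exists_convL1_sizeCount h j
    exact ⟨_, ((convL1_div_add_kap h hc).const_mul h (j + kap χ ρ - 1)).congr h fun l hl => by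
      rw [hl.avg_hits h hj]; ring⟩

lemma exists_convL1_avg_hits_mul_hits (h : Admissible χ ρ) (i j : ℕ) :
    ∃ c, ConvL1 χ ρ (fun l => avg χ ρ l (fun x => hits l i x * hits l j x)) c := by
  wlog hij : i ≤ j generalizing i j
  · obtain ⟨c, hc⟩ := this j i (by omega)
    exact ⟨c, hc.congr h fun l _ => by simp only [mul_comm]⟩
  rcases Nat.eq_zero_or_pos i with rfl | hi
  · obtain ⟨c, hc⟩ := exists_convL1_avg_hits h j
    exact ⟨c, hc.congr h fun l _ => (avg_hits_zero_mul_hits j).symm⟩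
  · obtain ⟨c, hc⟩ := exists_convL1_pairCount h j i
    exact ⟨_, ((convL1_div_add_kap h hc).const_mul h (i + kap χ ρ - 1)).congr h fun l hl => by
      rw [hl.avg_hits_mul_hits h hi hij]; ring⟩

lemma Reach.avg_sizeIncr (h : Admissible χ ρ) {l : List ℕ} (hl : Reach χ ρ l) (j : ℕ) :
    avg χ ρ l (sizeIncr l j)
      = ((if j = 0 then l.length + kap χ ρ else (j + kap χ ρ - 1) * sizeCount l j)
        - (j + kap χ ρ) * sizeCount l (j + 1)) / (l.length + kap χ ρ) := by
  have h1 := hl.avg_sizeCount_snoc h j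
  rw [hl.avg_sizeCount_snoc' h j, ← avg_sub] at h1
  have h2 : avg χ ρ l (sizeIncr l j) = avg χ ρ l fun x => hits l j x - hits l (j + 1) x := rfl
  rw [h2]
  linear_combination -h1

lemma convL1_avg_sizeIncr (h : Admissible χ ρ) (j : ℕ) :
    ConvL1 χ ρ (fun l => avg χ ρ l (sizeIncr l j)) (density χ ρ j) := by
  have hk := h.kap_pos
  have h0 := (convL1_div_add_kap h (convL1_sizeCount h j)).const_mul h (j + kap χ ρ)
  cases j with
  | zero =>
    have h1 := (ConvL1.const h 1).sub h h0
    have : density χ ρ 0 = 1 - ((0 : ℕ) + kap χ ρ) * density χ ρ 0 := by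
      unfold density; push_cast; field_simp; ring
    rw [← this] at h1
    refine h1.congr h fun l hl => ?_
    have hp := h.length_add_kap_pos l.length
    rw [hl.avg_sizeIncr h, if_pos rfl]
    field_simp
  | succ j =>
    have h1 := ((convL1_div_add_kap h (convL1_sizeCount h j)).const_mul h (j + kap χ ρ)).sub h h0
    have : density χ ρ (j + 1) = (j + kap χ ρ) * density χ ρ j
        - ((j + 1 : ℕ) + kap χ ρ) * density χ ρ (j + 1) := by
      unfold density; push_cast; field_simp; ring
    rw [← this] at h1
    refine h1.congr h fun l hl => ?_
    have hp := h.length_add_kap_pos l.length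
    rw [hl.avg_sizeIncr h, if_neg (by omega)]
    push_cast
    field_simp
    ring

lemma Reach.abs_avg_sizeIncr_le (h : Admissible χ ρ) {l : List ℕ} (hl : Reach χ ρ l) (j : ℕ) :
    |avg χ ρ l (sizeIncr l j)| ≤ 1 := by
  rw [← Real.norm_eq_abs]
  exact hl.norm_avg_le h fun x _ _ => by rw [Real.norm_eq_abs]; exact abs_sizeIncr_le l j x

lemma exists_convL1_condCov (h : Admissible χ ρ) (i j : ℕ) :
    ∃ c, ConvL1 χ ρ (fun l => condCov χ ρ l i j) c := by
  obtain ⟨c1, h1⟩ := exists_convL1_avg_hits_mul_hits h i j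
  obtain ⟨c2, h2⟩ := exists_convL1_avg_hits_mul_hits h i (j + 1)
  obtain ⟨c3, h3⟩ := exists_convL1_avg_hits_mul_hits h (i + 1) j
  obtain ⟨c4, h4⟩ := exists_convL1_avg_hits_mul_hits h (i + 1) (j + 1)
  have h5 := (((h1.sub h h2).sub h h3).add h h4).sub h
    ((convL1_avg_sizeIncr h i).mul h (convL1_avg_sizeIncr h j) (B := 1)
      fun l hl => hl.abs_avg_sizeIncr_le h i)
  refine ⟨_, h5.congr h fun l _ => ?_⟩
  unfold condCov
  rw [← avg_sub, ← avg_sub, ← avg_add]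
  congr 2
  funext x
  unfold sizeIncr
  ring

/-- The limit of the conditional covariances. -/
noncomputable def limCov (h : Admissible χ ρ) (i j : ℕ) : ℝ := (exists_convL1_condCov h i j).choose

lemma convL1_condCov (h : Admissible χ ρ) (i j : ℕ) :
    ConvL1 χ ρ (fun l => condCov χ ρ l i j) (limCov h i j) :=
  (exists_convL1_condCov h i j).choose_spec

lemma limCov_self_pos (h : Admissible χ ρ) (j : ℕ) : 0 < limCov h j j := by
  have hk := h.kap_pos
  have h1 := convL1_avg_sizeIncr h j
  have h2 := ((convL1_condCov h j j).sub h h1).add h (h1.mul h h1 (B := 1)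
    fun l hl => hl.abs_avg_sizeIncr_le h j)
  have h3 := h2.nonneg h fun l hl => by
    have := hl.avg_mono h fun x (_ : x ≤ l.length) _ => sizeIncr_le_sq l j x
    unfold condCov
    have e : avg χ ρ l (sizeIncr l j) = avg χ ρ l fun x => sizeIncr l j x := rfl
    rw [← e] at this
    linarith
  have hd0 : 0 < density χ ρ j := by unfold density; positivity
  have hd1 : density χ ρ j < 1 := by
    unfold density
    rw [div_lt_one (by positivity)]
    have : (0 : ℝ) ≤ j := j.cast_nonneg
    nlinarith
  nlinarith

end LimitConstants
end PATpaper

namespace PATpaper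
open Filter Topology

/-- Summation by parts turns the drift of the counts into this operator. -/
noncomputable def down (κ : ℝ) (f : ℕ → ℝ) : ℕ → ℝ
  | 0 => 0
  | j + 1 => (j + κ) * f j

/-- The deviation of the number of fringe subtrees with `j + 1` nodes from its asymptotic mean. -/
noncomputable def dev (χ ρ : ℝ) (l : List ℕ) (j : ℕ) : ℝ :=
  sizeCount l (j + 1) - density χ ρ j * (l.length + kap χ ρ)

/-- A linear combination of the deviations of the first `k` counts. -/
noncomputable def lin (χ ρ : ℝ) (k : ℕ) (t : ℕ → ℝ) (l : List ℕ) : ℝ :=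
  ∑ j ∈ Finset.range k, t j * dev χ ρ l j

/-- The action of one step of the growth process on the coefficients of `lin`. -/
noncomputable def pullback (κ : ℝ) (N : ℕ) (t : ℕ → ℝ) (j : ℕ) : ℝ :=
  t j + (j + κ) * (t (j + 1) - t j) / (N + κ)

/-- The quadratic form with matrix `S` in the first `k` variables. -/
noncomputable def quad (k : ℕ) (S : ℕ → ℕ → ℝ) (t : ℕ → ℝ) : ℝ :=
  ∑ i ∈ Finset.range k, ∑ j ∈ Finset.range k, t i * t j * S i j

/-- The solution of the Lyapunov equation for the asymptotic covariance matrix. -/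
noncomputable def asymCov (κ : ℝ) (Γ : ℕ → ℕ → ℝ) : ℕ → ℕ → ℝ
  | 0, 0 => Γ 0 0 / (1 + κ + κ)
  | i + 1, 0 => (Γ (i + 1) 0 + (i + κ) * asymCov κ Γ i 0) / (1 + ((i + 1 : ℕ) + κ) + κ)
  | 0, j + 1 => (Γ 0 (j + 1) + (j + κ) * asymCov κ Γ 0 j) / (1 + κ + ((j + 1 : ℕ) + κ))
  | i + 1, j + 1 => (Γ (i + 1) (j + 1) + (i + κ) * asymCov κ Γ i (j + 1)
      + (j + κ) * asymCov κ Γ (i + 1) j) / (1 + ((i + 1 : ℕ) + κ) + ((j + 1 : ℕ) + κ))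
termination_by i j => i + j

/-- The coefficient sequence `t` is supported on the first `k` indices and bounded by `R`. -/
structure Coeff (k : ℕ) (R : ℝ) (t : ℕ → ℝ) : Prop where
  supp : ∀ j, k ≤ j → t j = 0
  bound : ∀ j, |t j| ≤ R

section Algebra
variable {χ ρ : ℝ}

lemma asymCov_eq {κ : ℝ} (hκ : 0 < κ) (Γ : ℕ → ℕ → ℝ) (i j : ℕ) :
    (1 + (i + κ) + (j + κ)) * asymCov κ Γ i j
      = Γ i j + down κ (fun a => asymCov κ Γ a j) i + down κ (asymCov κ Γ i) j := by
  have h1 : 1 + ((i : ℝ) + κ) + (j + κ) ≠ 0 := by positivity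
  rcases i with _ | i <;> rcases j with _ | j
  · rw [asymCov]; simp only [down]; push_cast at h1 ⊢; field_simp; ring
  · rw [asymCov]; simp only [down]; push_cast at h1 ⊢; field_simp; ring
  · rw [asymCov]; simp only [down]; push_cast at h1 ⊢; field_simp; ring
  · rw [asymCov]; simp only [down]; push_cast at h1 ⊢; field_simp

lemma sum_by_parts (κ : ℝ) {k : ℕ} {t : ℕ → ℝ} (ht : t k = 0) (f : ℕ → ℝ) :
    ∑ j ∈ Finset.range k, (j + κ) * (t (j + 1) - t j) * f j
      = ∑ j ∈ Finset.range k, t j * (down κ f j - (j + κ) * f j) := by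
  have h1 := Finset.sum_range_succ' (fun j => t j * down κ f j) k
  rw [Finset.sum_range_succ, ht, zero_mul, add_zero] at h1
  have h0 : down κ f 0 = 0 := rfl
  have hs : ∀ j, down κ f (j + 1) = (j + κ) * f j := fun _ => rfl
  simp only [hs, h0, mul_zero, add_zero] at h1
  simp only [mul_sub (t _), Finset.sum_sub_distrib]
  rw [h1, ← Finset.sum_sub_distrib]
  exact Finset.sum_congr rfl fun j _ => by ring

lemma abs_quad_le (k : ℕ) (S : ℕ → ℕ → ℝ) {R : ℝ} {t : ℕ → ℝ}
    (ht : ∀ j < k, |t j| ≤ R) :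
    |quad k S t| ≤ (∑ i ∈ Finset.range k, ∑ j ∈ Finset.range k, |S i j|) * R ^ 2 := by
  unfold quad
  refine (Finset.abs_sum_le_sum_abs _ _).trans ?_
  rw [Finset.sum_mul]
  refine Finset.sum_le_sum fun i hi => (Finset.abs_sum_le_sum_abs _ _).trans ?_
  rw [Finset.sum_mul]
  refine Finset.sum_le_sum fun j hj => ?_
  have h1 := ht i (Finset.mem_range.1 hi)
  have h2 := ht j (Finset.mem_range.1 hj)
  rw [abs_mul, abs_mul, mul_comm, sq]
  exact mul_le_mul_of_nonneg_left (mul_le_mul h1 h2 (abs_nonneg _) ((abs_nonneg _).trans h1))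
    (abs_nonneg _)

lemma quad_const_mul (k : ℕ) (S : ℕ → ℕ → ℝ) (c : ℝ) (t : ℕ → ℝ) :
    quad k S (fun j => c * t j) = c ^ 2 * quad k S t := by
  simp only [quad, Finset.mul_sum]
  exact Finset.sum_congr rfl fun i _ => Finset.sum_congr rfl fun j _ => by ring

lemma quad_add_mul (k : ℕ) (S : ℕ → ℕ → ℝ) (c : ℝ) (t u : ℕ → ℝ) :
    quad k S (fun j => t j + c * u j) = quad k S t
      + c * (∑ i ∈ Finset.range k, ∑ j ∈ Finset.range k, (t i * u j + u i * t j) * S i j)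
      + c ^ 2 * quad k S u := by
  simp only [quad, Finset.mul_sum, ← Finset.sum_add_distrib]
  exact Finset.sum_congr rfl fun i _ => Finset.sum_congr rfl fun j _ => by ring

lemma quad_pullback {κ : ℝ} (hκ : 0 < κ) (Γ : ℕ → ℕ → ℝ) {k : ℕ} {t : ℕ → ℝ} (ht : t k = 0)
    (N : ℕ) :
    (N + 1 + κ) * quad k (asymCov κ Γ) t - (N + κ) * quad k (asymCov κ Γ) (pullback κ N t)
      = quad k Γ t
        - quad k (asymCov κ Γ) (fun j => (j + κ) * (t (j + 1) - t j)) / (N + κ) := by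
  set S := asymCov κ Γ with hS
  set u : ℕ → ℝ := fun j => (j + κ) * (t (j + 1) - t j) with hu
  have hp : (0 : ℝ) < N + κ := by positivity
  have h1 : pullback κ N t = fun j => t j + (1 / (N + κ)) * u j := by
    funext j; simp only [pullback, hu]; ring
  have h2 : ∑ i ∈ Finset.range k, ∑ j ∈ Finset.range k, (t i * u j + u i * t j) * S i j
      = quad k S t - quad k Γ t := by
    have e1 : ∀ i, ∑ j ∈ Finset.range k, t i * u j * S i j
        = ∑ j ∈ Finset.range k, t i * (t j * (down κ (S i) j - (j + κ) * S i j)) := by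
      intro i
      simp only [mul_assoc (t i), ← Finset.mul_sum]
      rw [← sum_by_parts κ ht (S i)]
    have e2 : ∀ j, ∑ i ∈ Finset.range k, u i * t j * S i j
        = ∑ i ∈ Finset.range k, t j * (t i * (down κ (fun a => S a j) i - (i + κ) * S i j)) := by
      intro j
      simp only [mul_comm (u _) (t j), mul_assoc (t j), ← Finset.mul_sum]
      rw [← sum_by_parts κ ht (fun a => S a j)]
    simp only [add_mul, Finset.sum_add_distrib]
    rw [Finset.sum_comm (f := fun i j => u i * t j * S i j)]
    simp only [e1, e2]
    rw [Finset.sum_comm (f := fun j i => t j * (t i * (down κ (fun a => S a j) i - _)))]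
    simp only [quad, ← Finset.sum_add_distrib, ← Finset.sum_sub_distrib]
    refine Finset.sum_congr rfl fun i _ => Finset.sum_congr rfl fun j _ => ?_
    have := asymCov_eq hκ Γ i j
    rw [← hS] at this
    linear_combination (-t i * t j) * this
  rw [h1, quad_add_mul, h2]
  field_simp
  ring

lemma Coeff.pullback {κ R : ℝ} (hκ : 0 < κ) {k N : ℕ} (hN : k ≤ N) {t : ℕ → ℝ}
    (ht : Coeff k R t) : Coeff k R (pullback κ N t) := by
  constructor
  · intro j hj
    simp [PATpaper.pullback, ht.supp j hj, ht.supp (j + 1) (by omega)]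
  · intro j
    rcases le_or_gt k j with hj | hj
    · simpa [PATpaper.pullback, ht.supp j hj, ht.supp (j + 1) (by omega)] using
        (abs_nonneg _).trans (ht.bound 0)
    · have hp : (0 : ℝ) < N + κ := by positivity
      have hj' : (j : ℝ) ≤ N := by exact_mod_cast (by omega : j ≤ N)
      set a := (j + κ) / (N + κ) with ha
      have h0 : 0 ≤ a := by positivity
      have h1 : a ≤ 1 := by rw [ha, div_le_one hp]; linarith
      have e : PATpaper.pullback κ N t j = (1 - a) * t j + a * t (j + 1) := by
        rw [PATpaper.pullback, ha]; field_simp; ring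
      have h2 := abs_le.1 (ht.bound j)
      have h3 := abs_le.1 (ht.bound (j + 1))
      rw [e, abs_le]
      constructor <;> nlinarith

/-- The centred increment of the count with index `j`. -/
noncomputable def noise (χ ρ : ℝ) (l : List ℕ) (j x : ℕ) : ℝ :=
  sizeIncr l j x - avg χ ρ l (sizeIncr l j)

lemma Reach.avg_sizeIncr_sub_density (h : Admissible χ ρ) {l : List ℕ} (hl : Reach χ ρ l) (j : ℕ) :
    avg χ ρ l (sizeIncr l j) - density χ ρ j
      = (down (kap χ ρ) (dev χ ρ l) j - (j + kap χ ρ) * dev χ ρ l j) / (l.length + kap χ ρ) := by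
  have hk := h.kap_pos
  have hp := h.length_add_kap_pos l.length
  rw [hl.avg_sizeIncr h]
  cases j with
  | zero =>
    simp only [down, dev, density, if_pos]
    push_cast
    field_simp
    ring
  | succ j =>
    simp only [down, dev, density]
    rw [if_neg (by omega)]
    push_cast
    field_simp
    ring

lemma Reach.lin_snoc (h : Admissible χ ρ) {l : List ℕ} (hl : Reach χ ρ l) {k x : ℕ}
    (hx : x ≤ l.length) {t : ℕ → ℝ} (ht : t k = 0) :
    lin χ ρ k t (l ++ [x]) = lin χ ρ k (pullback (kap χ ρ) l.length t) l
      + ∑ j ∈ Finset.range k, t j * noise χ ρ l j x := by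
  have hp := h.length_add_kap_pos l.length
  have h1 : ∀ j, dev χ ρ (l ++ [x]) j = dev χ ρ l j
      + (down (kap χ ρ) (dev χ ρ l) j - (j + kap χ ρ) * dev χ ρ l j) / (l.length + kap χ ρ)
      + noise χ ρ l j x := by
    intro j
    rw [← hl.avg_sizeIncr_sub_density h, noise, dev, sizeCount_snoc hx, dev, ← sizeIncr]
    simp only [List.length_append, List.length_singleton]
    push_cast
    ring
  have h2 := sum_by_parts (kap χ ρ) ht (dev χ ρ l)
  simp only [lin, h1, pullback]
  have h3 : ∑ j ∈ Finset.range k, t j * ((down (kap χ ρ) (dev χ ρ l) j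
        - (j + kap χ ρ) * dev χ ρ l j) / (l.length + kap χ ρ))
      = ∑ j ∈ Finset.range k, (j + kap χ ρ) * (t (j + 1) - t j) / (l.length + kap χ ρ)
        * dev χ ρ l j := by
    simp only [mul_div_assoc', div_mul_eq_mul_div, ← Finset.sum_div]
    rw [h2]
  simp only [mul_add (t _), add_mul (t _), Finset.sum_add_distrib]
  rw [h3]

lemma Reach.avg_noise (h : Admissible χ ρ) {l : List ℕ} (hl : Reach χ ρ l) (j : ℕ) :
    avg χ ρ l (noise χ ρ l j) = 0 := by
  have : noise χ ρ l j = fun x => sizeIncr l j x - avg χ ρ l (sizeIncr l j) := rfl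
  rw [this, avg_sub, hl.avg_const h]
  exact sub_self _

lemma Reach.avg_noise_mul_noise (h : Admissible χ ρ) {l : List ℕ} (hl : Reach χ ρ l) (i j : ℕ) :
    avg χ ρ l (fun x => noise χ ρ l i x * noise χ ρ l j x) = condCov χ ρ l i j := by
  have : (fun x => noise χ ρ l i x * noise χ ρ l j x) = fun x =>
      sizeIncr l i x * sizeIncr l j x - avg χ ρ l (sizeIncr l i) * sizeIncr l j x
        - avg χ ρ l (sizeIncr l j) * noise χ ρ l i x := by
    funext x; simp only [noise]; ring
  rw [this, avg_sub, avg_sub, avg_const_mul, avg_const_mul]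
  have e : (avg χ ρ l fun v => noise χ ρ l i v) = 0 := hl.avg_noise h i
  rw [e, mul_zero, sub_zero, condCov]

lemma Reach.abs_noise_le (h : Admissible χ ρ) {l : List ℕ} (hl : Reach χ ρ l) (j x : ℕ) :
    |noise χ ρ l j x| ≤ 2 := by
  have h1 := abs_sizeIncr_le l j x
  have h2 := hl.abs_avg_sizeIncr_le h j
  have := abs_sub (sizeIncr l j x) (avg χ ρ l (sizeIncr l j))
  unfold noise
  linarith

lemma Reach.avg_sum_noise (h : Admissible χ ρ) {l : List ℕ} (hl : Reach χ ρ l) (k : ℕ)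
    (t : ℕ → ℝ) : avg χ ρ l (fun x => ∑ j ∈ Finset.range k, t j * noise χ ρ l j x) = 0 := by
  rw [avg_sum]
  refine Finset.sum_eq_zero fun j _ => ?_
  rw [avg_const_mul]
  have e : (avg χ ρ l fun v => noise χ ρ l j v) = 0 := hl.avg_noise h j
  rw [e, mul_zero]

lemma Reach.avg_sum_noise_sq (h : Admissible χ ρ) {l : List ℕ} (hl : Reach χ ρ l) (k : ℕ)
    (t : ℕ → ℝ) : avg χ ρ l (fun x => (∑ j ∈ Finset.range k, t j * noise χ ρ l j x) ^ 2)
      = quad k (condCov χ ρ l) t := by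
  have : (fun x => (∑ j ∈ Finset.range k, t j * noise χ ρ l j x) ^ 2) = fun x =>
      ∑ i ∈ Finset.range k, ∑ j ∈ Finset.range k,
        (t i * t j) * (noise χ ρ l i x * noise χ ρ l j x) := by
    funext x
    rw [sq, Finset.sum_mul_sum]
    exact Finset.sum_congr rfl fun i _ => Finset.sum_congr rfl fun j _ => by ring
  rw [this, avg_sum]
  refine Finset.sum_congr rfl fun i _ => ?_
  rw [avg_sum]
  refine Finset.sum_congr rfl fun j _ => ?_
  rw [avg_const_mul, hl.avg_noise_mul_noise h]

lemma Reach.abs_sum_noise_le (h : Admissible χ ρ) {l : List ℕ} (hl : Reach χ ρ l) {k : ℕ} {R : ℝ}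
    {t : ℕ → ℝ} (ht : Coeff k R t) (x : ℕ) :
    |∑ j ∈ Finset.range k, t j * noise χ ρ l j x| ≤ 2 * k * R := by
  have hR : 0 ≤ R := (abs_nonneg _).trans (ht.bound 0)
  calc _ ≤ ∑ j ∈ Finset.range k, |t j * noise χ ρ l j x| := Finset.abs_sum_le_sum_abs _ _
    _ ≤ ∑ j ∈ Finset.range k, R * 2 := by
        refine Finset.sum_le_sum fun j _ => ?_
        rw [abs_mul]
        exact mul_le_mul (ht.bound j) (hl.abs_noise_le h j x) (abs_nonneg _) hR
    _ = _ := by rw [Finset.sum_const, Finset.card_range, nsmul_eq_mul]; ring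

lemma Reach.norm_avg_exp_sub_one_le (h : Admissible χ ρ) {l : List ℕ} (hl : Reach χ ρ l)
    {ζ : ℕ → ℝ} {a b : ℝ} (h0 : avg χ ρ l ζ = 0) (hζ : ∀ x, |ζ x| ≤ b) (ha : |a| ≤ b) :
    ‖avg χ ρ l (fun x => Complex.exp (ζ x * Complex.I + a)) - 1‖
      ≤ |a - avg χ ρ l (fun x => ζ x ^ 2) / 2| + a ^ 2 / 2 + (2 * b) ^ 3 * Real.exp (2 * b) := by
  have hb : 0 ≤ b := (abs_nonneg _).trans ha
  have hz : ∀ x, ‖(ζ x * Complex.I + a : ℂ)‖ ≤ 2 * b := by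
    intro x
    refine (norm_add_le _ _).trans ?_
    rw [norm_mul, Complex.norm_I, mul_one, Complex.norm_real, Complex.norm_real,
      Real.norm_eq_abs, Real.norm_eq_abs]
    linarith [hζ x]
  have hcast : ∀ g : ℕ → ℝ, avg χ ρ l (fun x => (g x : ℂ)) = ((avg χ ρ l g : ℝ) : ℂ) := by
    intro g
    simp [avg, Complex.ofReal_sum]
  have hrem : ‖avg χ ρ l (fun x => Complex.exp (ζ x * Complex.I + a)
      - (1 + (ζ x * Complex.I + a) + (ζ x * Complex.I + a) ^ 2 / 2))‖
      ≤ (2 * b) ^ 3 * Real.exp (2 * b) := by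
    refine hl.norm_avg_le h fun x _ _ => ?_
    have h1 := Complex.norm_exp_sub_sum_le_norm_mul_exp (ζ x * Complex.I + a) 3
    rw [Finset.sum_range_succ, Finset.sum_range_succ, Finset.sum_range_one] at h1
    simp only [pow_zero, Nat.factorial, pow_one, Nat.cast_one, div_one] at h1
    norm_num at h1
    refine h1.trans ?_
    gcongr
    · exact hz x
    · exact hz x
  have hmain : avg χ ρ l (fun x => (1 + (ζ x * Complex.I + a) + (ζ x * Complex.I + a) ^ 2 / 2 : ℂ))
      = 1 + ((a - avg χ ρ l (fun x => ζ x ^ 2) / 2 : ℝ) : ℂ) + ((a ^ 2 / 2 : ℝ) : ℂ) := by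
    have e : (fun x => (1 + (ζ x * Complex.I + a) + (ζ x * Complex.I + a) ^ 2 / 2 : ℂ))
        = fun x => (((1 + a + a ^ 2 / 2 : ℝ) : ℂ) + ((Complex.I * (1 + a)) * ((ζ x : ℝ) : ℂ)))
          - (1 / 2 : ℂ) * ((ζ x ^ 2 : ℝ) : ℂ) := by
      funext x
      push_cast
      linear_combination ((ζ x : ℂ) ^ 2 / 2) * Complex.I_sq
    rw [e, avg_sub, avg_add, hl.avg_const h, avg_const_mul, avg_const_mul, hcast,
      hcast (fun x => ζ x ^ 2)]
    have e0 : (avg χ ρ l fun x => ζ x) = 0 := h0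
    rw [e0]
    push_cast
    ring
  have hsplit : avg χ ρ l (fun x => Complex.exp (ζ x * Complex.I + a)) - 1
      = ((a - avg χ ρ l (fun x => ζ x ^ 2) / 2 : ℝ) : ℂ) + ((a ^ 2 / 2 : ℝ) : ℂ)
        + avg χ ρ l (fun x => Complex.exp (ζ x * Complex.I + a)
          - (1 + (ζ x * Complex.I + a) + (ζ x * Complex.I + a) ^ 2 / 2)) := by
    rw [avg_sub, hmain]; ring
  rw [hsplit]
  refine (norm_add_le _ _).trans (add_le_add ((norm_add_le _ _).trans ?_) hrem)
  rw [Complex.norm_real, Complex.norm_real, Real.norm_eq_abs, Real.norm_eq_abs,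
    abs_of_nonneg (by positivity : 0 ≤ a ^ 2 / 2)]

end Algebra
end PATpaper

namespace PATpaper
open Filter Topology

/-- The characteristic function of the vector of deviations in the tree with `N + 1` nodes,
divided by its Gaussian approximation. -/
noncomputable def charRatio (χ ρ : ℝ) (k : ℕ) (S : ℕ → ℕ → ℝ) (N : ℕ) (t : ℕ → ℝ) : ℂ :=
  ex χ ρ (N + 1) (fun l => Complex.exp ((lin χ ρ k t l : ℝ) * Complex.I))
    * (Real.exp ((N + kap χ ρ) * quad k S t / 2) : ℝ)

/-- The total absolute deviation of the conditional covariances from `Γ`. -/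
noncomputable def covDev (χ ρ : ℝ) (k : ℕ) (Γ : ℕ → ℕ → ℝ) (l : List ℕ) : ℝ :=
  ∑ i ∈ Finset.range k, ∑ j ∈ Finset.range k, |condCov χ ρ l i j - Γ i j|

section CharacteristicFunction
variable {χ ρ : ℝ}

lemma charRatio_succ_sub (h : Admissible χ ρ) {k : ℕ} {t : ℕ → ℝ} (ht : t k = 0)
    (S : ℕ → ℕ → ℝ) (N : ℕ) {a : ℝ}
    (ha : (N + 1 + kap χ ρ) * quad k S t - (N + kap χ ρ) * quad k S (pullback (kap χ ρ) N t)
      = 2 * a) :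
    charRatio χ ρ k S (N + 1) t - charRatio χ ρ k S N (pullback (kap χ ρ) N t)
      = (Real.exp ((N + kap χ ρ) * quad k S (pullback (kap χ ρ) N t) / 2) : ℝ)
        * ex χ ρ (N + 1) (fun l =>
          Complex.exp ((lin χ ρ k (pullback (kap χ ρ) N t) l : ℝ) * Complex.I)
          * (avg χ ρ l (fun x => Complex.exp
              ((∑ j ∈ Finset.range k, t j * noise χ ρ l j x : ℝ) * Complex.I + a)) - 1)) := by
  set t' := pullback (kap χ ρ) N t with ht'
  have h1 : ex χ ρ (N + 1 + 1) (fun l => Complex.exp ((lin χ ρ k t l : ℝ) * Complex.I))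
      * (Real.exp a : ℝ) = ex χ ρ (N + 1) (fun l =>
        Complex.exp ((lin χ ρ k t' l : ℝ) * Complex.I) * avg χ ρ l (fun x => Complex.exp
              ((∑ j ∈ Finset.range k, t j * noise χ ρ l j x : ℝ) * Complex.I + a))) := by
    rw [ex_succ (by omega), mul_comm, ← ex_const_mul]
    refine ex_congr h (by omega) fun l hl hln => ?_
    rw [← avg_const_mul, ← avg_const_mul]
    refine hl.avg_congr h fun x hx _ => ?_
    have hN : l.length = N := by omega
    rw [hl.lin_snoc h hx ht, hN, ← ht', Complex.ofReal_exp, ← Complex.exp_add, ← Complex.exp_add]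
    congr 1
    push_cast
    ring
  have h2 : Real.exp (((N + 1 : ℕ) + kap χ ρ) * quad k S t / 2)
      = Real.exp ((N + kap χ ρ) * quad k S t' / 2) * Real.exp a := by
    rw [← Real.exp_add]
    congr 1
    push_cast
    linear_combination ha / 2
  unfold charRatio
  rw [h2, Complex.ofReal_mul]
  simp only [mul_sub, mul_one, ex_sub, ← h1]
  ring

lemma Reach.abs_sub_quad_condCov_le {k : ℕ} (Γ : ℕ → ℕ → ℝ) {R : ℝ} {t : ℕ → ℝ}
    (ht : Coeff k R t) (l : List ℕ) :
    |quad k Γ t - quad k (condCov χ ρ l) t| ≤ covDev χ ρ k Γ l * R ^ 2 := by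
  have h1 : quad k Γ t - quad k (condCov χ ρ l) t
      = -quad k (fun i j => condCov χ ρ l i j - Γ i j) t := by
    simp only [quad, ← Finset.sum_sub_distrib, ← Finset.sum_neg_distrib]
    exact Finset.sum_congr rfl fun i _ => Finset.sum_congr rfl fun j _ => by ring
  rw [h1, abs_neg]
  exact abs_quad_le k _ fun j _ => ht.bound j

set_option maxHeartbeats 1000000 in
lemma charRatio_step (h : Admissible χ ρ) (k : ℕ) (Γ : ℕ → ℕ → ℝ) :
    ∃ C : ℝ, 0 ≤ C ∧ ∀ N, k ≤ N → ∀ R ≤ 1, ∀ t, Coeff k R t →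
      ‖charRatio χ ρ k (asymCov (kap χ ρ) Γ) (N + 1) t
        - charRatio χ ρ k (asymCov (kap χ ρ) Γ) N (pullback (kap χ ρ) N t)‖
      ≤ Real.exp (C * (N + kap χ ρ) * R ^ 2) * (C * R ^ 2
        * (R + 1 / ((N : ℝ) + 1) + ex χ ρ (N + 1) (covDev χ ρ k Γ))) := by
  have hκ := h.kap_pos
  set κ := kap χ ρ with hκdef
  set S := asymCov κ Γ with hS
  obtain ⟨A, hA, hAn⟩ := h.exists_length_le
  set s := ∑ i ∈ Finset.range k, ∑ j ∈ Finset.range k, |S i j| with hs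
  set γ := ∑ i ∈ Finset.range k, ∑ j ∈ Finset.range k, |Γ i j| with hγ
  have hs0 : 0 ≤ s := Finset.sum_nonneg fun _ _ => Finset.sum_nonneg fun _ _ => abs_nonneg _
  have hγ0 : 0 ≤ γ := Finset.sum_nonneg fun _ _ => Finset.sum_nonneg fun _ _ => abs_nonneg _
  set L : ℝ := k + κ with hL
  have hL0 : 0 ≤ L := by positivity
  set C0 : ℝ := 4 * s * L ^ 2 * A with hC0
  have hC00 : 0 ≤ C0 := by positivity
  set C1 : ℝ := γ + C0 + 2 * k with hC1
  have hC10 : 0 ≤ C1 := by positivity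
  set C : ℝ := 1 + s + C0 + C1 ^ 2 + 8 * C1 ^ 3 * Real.exp (2 * C1) with hC
  have hC0' : 0 ≤ C := by positivity
  refine ⟨C, hC0', fun N hN R hR1 t ht => ?_⟩
  have hR : 0 ≤ R := (abs_nonneg _).trans (ht.bound 0)
  have hp : (0 : ℝ) < N + κ := by positivity
  set u : ℕ → ℝ := fun j => (j + κ) * (t (j + 1) - t j) with hu
  have hub : ∀ j < k, |u j| ≤ 2 * L * R := by
    intro j hj
    have hj' : (j : ℝ) ≤ k := by exact_mod_cast hj.le
    rw [hu]
    simp only [abs_mul]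
    rw [abs_of_nonneg (by positivity : (0 : ℝ) ≤ j + κ)]
    have h1 : |t (j + 1) - t j| ≤ 2 * R := by
      have := abs_sub (t (j + 1)) (t j)
      linarith [ht.bound (j + 1), ht.bound j]
    calc (j + κ) * |t (j + 1) - t j| ≤ L * (2 * R) :=
          mul_le_mul (by rw [hL]; linarith) h1 (abs_nonneg _) hL0
      _ = _ := by ring
  have hQu : |quad k S u / (N + κ)| ≤ C0 * R ^ 2 * (1 / ((N : ℝ) + 1)) := by
    have h1 := abs_quad_le k S hub
    rw [← hs] at h1
    have h2 : 1 / (N + κ) ≤ A * (1 / ((N : ℝ) + 1)) := by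
      rw [mul_one_div, div_le_div_iff₀ hp (by positivity), one_mul]
      exact hAn N
    rw [div_eq_mul_one_div, abs_mul, abs_of_pos (one_div_pos.2 hp)]
    calc _ ≤ (s * (2 * L * R) ^ 2) * (A * (1 / ((N : ℝ) + 1))) :=
          mul_le_mul h1 h2 (one_div_pos.2 hp).le (by positivity)
      _ = _ := by rw [hC0]; ring
  set a : ℝ := (quad k Γ t - quad k S u / (N + κ)) / 2 with ha
  have hinv : 1 / ((N : ℝ) + 1) ≤ 1 := by
    rw [div_le_one (by positivity)]
    linarith [(N.cast_nonneg : (0 : ℝ) ≤ N)]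
  have hinv0 : 0 ≤ 1 / ((N : ℝ) + 1) := by positivity
  have haR : |a| ≤ (γ + C0) * R ^ 2 := by
    have h1 := abs_quad_le k Γ fun j (_ : j < k) => ht.bound j
    rw [← hγ] at h1
    have h2 : C0 * R ^ 2 * (1 / ((N : ℝ) + 1)) ≤ C0 * R ^ 2 :=
      mul_le_of_le_one_right (by positivity) hinv
    have h3 := abs_sub (quad k Γ t) (quad k S u / (N + κ))
    have h4 : |a| ≤ |quad k Γ t - quad k S u / (N + κ)| := by
      rw [ha, abs_div, abs_two]
      exact div_le_self (abs_nonneg _) (by norm_num)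
    linarith
  have hRR : R ^ 2 ≤ R := by nlinarith only [hR, hR1]
  have hab : |a| ≤ C1 * R := by
    refine haR.trans ?_
    calc (γ + C0) * R ^ 2 ≤ (γ + C0) * R := mul_le_mul_of_nonneg_left hRR (by positivity)
      _ ≤ C1 * R := mul_le_mul_of_nonneg_right
        (by rw [hC1]; linarith [(k.cast_nonneg : (0 : ℝ) ≤ k)]) hR
  have ha2 : a ^ 2 / 2 ≤ C1 ^ 2 * (R ^ 2 * R) := by
    have h1 : |a| ≤ C1 * R ^ 2 := haR.trans (mul_le_mul_of_nonneg_right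
        (by rw [hC1]; linarith [(k.cast_nonneg : (0 : ℝ) ≤ k)]) (sq_nonneg R))
    have h2 : a ^ 2 ≤ (C1 * R) * (C1 * R ^ 2) := by
      rw [← sq_abs, sq]
      exact mul_le_mul hab h1 (abs_nonneg _) (by positivity)
    have h3 : (C1 * R) * (C1 * R ^ 2) = C1 ^ 2 * (R ^ 2 * R) := by ring
    linarith only [h2, h3, sq_nonneg a]
  rw [charRatio_succ_sub h (ht.supp k le_rfl) S N (a := a) (by
    rw [← hκdef, hS, quad_pullback hκ Γ (ht.supp k le_rfl), ha]; ring), norm_mul]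
  refine mul_le_mul ?_ ?_ (norm_nonneg _) (Real.exp_pos _).le
  · rw [Complex.norm_real, Real.norm_of_nonneg (Real.exp_pos _).le]
    refine Real.exp_le_exp.2 ?_
    have h1 := (abs_le.1 (abs_quad_le k S fun j (_ : j < k) => (ht.pullback hκ hN).bound j)).2
    rw [← hs] at h1
    have h2 : s * R ^ 2 ≤ C * R ^ 2 := by
      refine mul_le_mul_of_nonneg_right ?_ (sq_nonneg R)
      have : 0 ≤ C1 ^ 2 + 8 * C1 ^ 3 * Real.exp (2 * C1) := by positivity
      rw [hC]; linarith only [this, hs0, hC00]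
    have h3 : (N + κ) * quad k S (pullback κ N t) ≤ (N + κ) * (C * R ^ 2) :=
      mul_le_mul_of_nonneg_left (h1.trans h2) hp.le
    have h4 : 0 ≤ (N + κ) * (C * R ^ 2) := by positivity
    have h5 : C * (N + κ) * R ^ 2 = (N + κ) * (C * R ^ 2) := by ring
    linarith
  · refine (norm_ex_le h (by omega) _).trans ?_
    have hrhs : C * R ^ 2 * (R + 1 / ((N : ℝ) + 1) + ex χ ρ (N + 1) (covDev χ ρ k Γ))
        = ex χ ρ (N + 1) (fun l => C * R ^ 2 * (R + 1 / ((N : ℝ) + 1) + covDev χ ρ k Γ l)) := by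
      rw [ex_const_mul, ex_add, ex_const h (by omega)]
    rw [hrhs]
    refine ex_mono h (by omega) fun l hl _ => ?_
    rw [norm_mul, Complex.norm_exp_ofReal_mul_I, one_mul]
    refine (hl.norm_avg_exp_sub_one_le h (b := C1 * R) (hl.avg_sum_noise h k t) (fun x => ?_)
      hab).trans ?_
    · refine (hl.abs_sum_noise_le h ht x).trans (mul_le_mul_of_nonneg_right ?_ hR)
      rw [hC1]; linarith
    · rw [hl.avg_sum_noise_sq h]
      have hcd : 0 ≤ covDev χ ρ k Γ l :=
        Finset.sum_nonneg fun _ _ => Finset.sum_nonneg fun _ _ => abs_nonneg _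
      have e1 : |a - quad k (condCov χ ρ l) t / 2|
          ≤ covDev χ ρ k Γ l * R ^ 2 + C0 * R ^ 2 * (1 / ((N : ℝ) + 1)) := by
        have h1 : a - quad k (condCov χ ρ l) t / 2
            = ((quad k Γ t - quad k (condCov χ ρ l) t) - quad k S u / (N + κ)) / 2 := by
          rw [ha]; ring
        rw [h1, abs_div, abs_two]
        refine (div_le_self (abs_nonneg _) (by norm_num)).trans ((abs_sub _ _).trans ?_)
        exact add_le_add (Reach.abs_sub_quad_condCov_le Γ ht l) hQu
      have e2 : (2 * (C1 * R)) ^ 3 * Real.exp (2 * (C1 * R))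
          ≤ 8 * C1 ^ 3 * Real.exp (2 * C1) * (R ^ 2 * R) := by
        have h1 : Real.exp (2 * (C1 * R)) ≤ Real.exp (2 * C1) := by
          refine Real.exp_le_exp.2 ?_
          nlinarith only [hR, hR1, hC10]
        calc _ ≤ (2 * (C1 * R)) ^ 3 * Real.exp (2 * C1) :=
              mul_le_mul_of_nonneg_left h1 (by positivity)
          _ = _ := by ring
      set E := 8 * C1 ^ 3 * Real.exp (2 * C1) with hE
      have hE0 : 0 ≤ E := by positivity
      have m1 : 0 ≤ (C - 1) * (R ^ 2 * covDev χ ρ k Γ l) :=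
        mul_nonneg (by rw [hC]; linarith only [sq_nonneg C1, hs0, hC00, hE0]) (by positivity)
      have m2 : 0 ≤ (C - C0) * (R ^ 2 * (1 / ((N : ℝ) + 1))) :=
        mul_nonneg (by rw [hC]; linarith only [sq_nonneg C1, hs0, hC00, hE0]) (by positivity)
      have m3 : 0 ≤ (C - C1 ^ 2 - E) * (R ^ 2 * R) :=
        mul_nonneg (by rw [hC]; linarith only [sq_nonneg C1, hs0, hC00, hE0]) (by positivity)
      linarith only [e1, e2, ha2, m1, m2, m3]

lemma tendsto_ex_covDev (h : Admissible χ ρ) (k : ℕ) :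
    Tendsto (fun N => ex χ ρ (N + 1) (covDev χ ρ k (limCov h))) atTop (𝓝 0) := by
  have h1 : Tendsto (fun n => ex χ ρ n (covDev χ ρ k (limCov h))) atTop (𝓝 0) := by
    have h2 : Tendsto (fun n => ∑ i ∈ Finset.range k, ∑ j ∈ Finset.range k,
        ex χ ρ n (fun l => |condCov χ ρ l i j - limCov h i j|)) atTop
        (𝓝 (∑ i ∈ Finset.range k, ∑ j ∈ Finset.range k, (0 : ℝ))) :=
      tendsto_finsetSum _ fun i _ => tendsto_finsetSum _ fun j _ => convL1_condCov h i j
    simp only [Finset.sum_const_zero] at h2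
    refine h2.congr fun n => ?_
    unfold covDev
    rw [ex_sum]
    exact Finset.sum_congr rfl fun i _ => (ex_sum n _ _).symm
  exact h1.comp (tendsto_add_atTop_nat 1)

end CharacteristicFunction
end PATpaper

namespace PATpaper
open Filter Topology

section CentralLimit
variable {χ ρ : ℝ}

lemma Coeff.nonneg {k : ℕ} {R : ℝ} {t : ℕ → ℝ} (ht : Coeff k R t) : 0 ≤ R :=
  (abs_nonneg _).trans (ht.bound 0)

lemma Coeff.const_mul {k : ℕ} {R : ℝ} {t : ℕ → ℝ} (ht : Coeff k R t) {c : ℝ} (hc : 0 ≤ c) :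
    Coeff k (c * R) (fun j => c * t j) where
  supp j hj := by rw [ht.supp j hj, mul_zero]
  bound j := by
    rw [abs_mul, abs_of_nonneg hc]
    exact mul_le_mul_of_nonneg_left (ht.bound j) hc

lemma abs_lin_le {k : ℕ} {R : ℝ} {t : ℕ → ℝ} (ht : Coeff k R t) (l : List ℕ) :
    |lin χ ρ k t l| ≤ R * ∑ j ∈ Finset.range k, |dev χ ρ l j| := by
  unfold lin
  refine (Finset.abs_sum_le_sum_abs _ _).trans ?_
  rw [Finset.mul_sum]
  refine Finset.sum_le_sum fun j _ => ?_
  rw [abs_mul]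
  exact mul_le_mul_of_nonneg_right (ht.bound j) (abs_nonneg _)

lemma charRatio_base (h : Admissible χ ρ) (k : ℕ) (S : ℕ → ℕ → ℝ) (N : ℕ) :
    ∃ W : ℝ, 0 ≤ W ∧ ∀ R ≤ 1, ∀ t, Coeff k R t → ‖charRatio χ ρ k S N t - 1‖ ≤ W * R := by
  have hp := h.length_add_kap_pos N
  set W1 : ℝ := ex χ ρ (N + 1) (fun l => ∑ j ∈ Finset.range k, |dev χ ρ l j|) with hW1
  have hW10 : 0 ≤ W1 := ex_nonneg h (by omega) fun l _ _ =>
    Finset.sum_nonneg fun _ _ => abs_nonneg _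
  set s := ∑ i ∈ Finset.range k, ∑ j ∈ Finset.range k, |S i j| with hs
  have hs0 : 0 ≤ s := Finset.sum_nonneg fun _ _ => Finset.sum_nonneg fun _ _ => abs_nonneg _
  set v0 : ℝ := (N + kap χ ρ) * s with hv0
  have hv00 : 0 ≤ v0 := by positivity
  refine ⟨W1 * Real.exp v0 + v0 * Real.exp v0, by positivity, fun R hR1 t ht => ?_⟩
  have hR := ht.nonneg
  set x : ℂ := ex χ ρ (N + 1) (fun l => Complex.exp ((lin χ ρ k t l : ℝ) * Complex.I)) with hx
  set v : ℝ := (N + kap χ ρ) * quad k S t / 2 with hv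
  have hx1 : ‖x - 1‖ ≤ W1 * R := by
    have e1 : x - 1 = ex χ ρ (N + 1)
        (fun l => Complex.exp ((lin χ ρ k t l : ℝ) * Complex.I) - 1) := by
      rw [ex_sub, ex_const h (by omega)]
    rw [e1]
    refine (norm_ex_le h (by omega) _).trans ?_
    rw [mul_comm, hW1, ← ex_const_mul]
    refine ex_mono h (by omega) fun l _ _ => ?_
    rw [mul_comm]
    refine (Real.norm_exp_I_mul_ofReal_sub_one_le).trans ?_
    rw [Real.norm_eq_abs]
    exact abs_lin_le ht l
  have hvb : |v| ≤ v0 * R := by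
    have h1 := abs_quad_le k S fun j (_ : j < k) => ht.bound j
    rw [← hs] at h1
    have h2 : R ^ 2 ≤ R := by nlinarith only [hR, hR1]
    have h3 : s * R ^ 2 ≤ s * R := mul_le_mul_of_nonneg_left h2 hs0
    rw [hv, abs_div, abs_two, abs_mul, abs_of_pos hp]
    refine (div_le_self (by positivity) (by norm_num)).trans ?_
    calc _ ≤ (N + kap χ ρ) * (s * R) := mul_le_mul_of_nonneg_left (h1.trans h3) hp.le
      _ = _ := by rw [hv0]; ring
  have hvb' : |v| ≤ v0 := hvb.trans (mul_le_of_le_one_right hv00 hR1)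
  have hy1 : ‖((Real.exp v : ℝ) : ℂ) - 1‖ ≤ v0 * R * Real.exp v0 := by
    have h1 := Complex.norm_exp_sub_sum_le_norm_mul_exp (v : ℂ) 1
    rw [Finset.sum_range_one] at h1
    simp only [pow_zero, Nat.factorial, pow_one, Nat.cast_one, div_one, Complex.norm_real,
      Real.norm_eq_abs] at h1
    rw [Complex.ofReal_exp]
    exact h1.trans (mul_le_mul hvb (Real.exp_le_exp.2 hvb') (Real.exp_pos _).le (by positivity))
  have hy : ‖((Real.exp v : ℝ) : ℂ)‖ ≤ Real.exp v0 := by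
    rw [Complex.norm_real, Real.norm_of_nonneg (Real.exp_pos _).le]
    exact Real.exp_le_exp.2 ((le_abs_self v).trans hvb')
  have hsplit : charRatio χ ρ k S N t - 1
      = (x - 1) * ((Real.exp v : ℝ) : ℂ) + (((Real.exp v : ℝ) : ℂ) - 1) := by
    unfold charRatio; ring
  rw [hsplit]
  refine (norm_add_le _ _).trans ?_
  rw [norm_mul]
  have h1 : ‖x - 1‖ * ‖((Real.exp v : ℝ) : ℂ)‖ ≤ W1 * R * Real.exp v0 :=
    mul_le_mul hx1 hy (norm_nonneg _) (by positivity)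
  linarith only [h1, hy1]

lemma charRatio_sub_one_le (h : Admissible χ ρ) (k : ℕ) (Γ : ℕ → ℕ → ℝ) :
    ∃ W C : ℝ, 0 ≤ W ∧ 0 ≤ C ∧ ∀ N, k ≤ N → ∀ R ≤ 1, ∀ t, Coeff k R t →
      ‖charRatio χ ρ k (asymCov (kap χ ρ) Γ) N t - 1‖
      ≤ W * R + Real.exp (C * (N + kap χ ρ) * R ^ 2) * (C * R ^ 2
        * ∑ M ∈ Finset.range N, (R + 1 / ((M : ℝ) + 1) + ex χ ρ (M + 1) (covDev χ ρ k Γ))) := by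
  obtain ⟨W, hW, hbase⟩ := charRatio_base h k (asymCov (kap χ ρ) Γ) k
  obtain ⟨C, hC, hstep⟩ := charRatio_step h k Γ
  refine ⟨W, C, hW, hC, fun N hN R hR1 => ?_⟩
  have hη : 0 ≤ R → ∀ M : ℕ, 0 ≤ R + 1 / ((M : ℝ) + 1) + ex χ ρ (M + 1) (covDev χ ρ k Γ) := by
    intro hR M
    have : 0 ≤ ex χ ρ (M + 1) (covDev χ ρ k Γ) := ex_nonneg h (by omega) fun l _ _ =>
      Finset.sum_nonneg fun _ _ => Finset.sum_nonneg fun _ _ => abs_nonneg _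
    positivity
  induction N, hN using Nat.le_induction with
  | base =>
    intro t ht
    refine (hbase R hR1 t ht).trans ?_
    have := Finset.sum_nonneg fun M (_ : M ∈ Finset.range k) => hη ht.nonneg M
    have : 0 ≤ Real.exp (C * (k + kap χ ρ) * R ^ 2) * (C * R ^ 2
        * ∑ M ∈ Finset.range k, (R + 1 / ((M : ℝ) + 1) + ex χ ρ (M + 1) (covDev χ ρ k Γ))) := by
      positivity
    linarith
  | succ N hN ih =>
    intro t ht
    have h1 := hstep N hN R hR1 t ht
    have h2 := ih _ (ht.pullback h.kap_pos hN)
    have h3 := norm_add_le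
      (charRatio χ ρ k (asymCov (kap χ ρ) Γ) (N + 1) t
        - charRatio χ ρ k (asymCov (kap χ ρ) Γ) N (pullback (kap χ ρ) N t))
      (charRatio χ ρ k (asymCov (kap χ ρ) Γ) N (pullback (kap χ ρ) N t) - 1)
    rw [sub_add_sub_cancel] at h3
    have hmono : Real.exp (C * (N + kap χ ρ) * R ^ 2)
        ≤ Real.exp (C * ((N + 1 : ℕ) + kap χ ρ) * R ^ 2) := by
      refine Real.exp_le_exp.2 (mul_le_mul_of_nonneg_right (mul_le_mul_of_nonneg_left ?_ hC)
        (sq_nonneg R))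
      push_cast; linarith
    have hnn : 0 ≤ C * R ^ 2
        * ∑ M ∈ Finset.range (N + 1), (R + 1 / ((M : ℝ) + 1) + ex χ ρ (M + 1) (covDev χ ρ k Γ)) :=
      mul_nonneg (by positivity) (Finset.sum_nonneg fun M _ => hη ht.nonneg M)
    have h4 := mul_le_mul_of_nonneg_right hmono hnn
    rw [Finset.sum_range_succ] at h4 ⊢
    linarith only [h1, h2, h3, h4]

lemma tendsto_cesaro_inv_sqrt {e : ℕ → ℝ} (he : Tendsto e atTop (𝓝 0)) (r : ℝ) :
    Tendsto (fun N : ℕ => ((N : ℝ) + 1)⁻¹ * ∑ M ∈ Finset.range (N + 1),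
      (r / √((N : ℝ) + 1) + 1 / ((M : ℝ) + 1) + e M)) atTop (𝓝 0) := by
  have h1 : Tendsto (fun M : ℕ => 1 / ((M : ℝ) + 1) + e M) atTop (𝓝 0) := by
    simpa using tendsto_one_div_add_atTop_nhds_zero_nat.add he
  have h2 := h1.cesaro.comp (tendsto_add_atTop_nat 1)
  have h3 : Tendsto (fun N : ℕ => r / √((N : ℝ) + 1)) atTop (𝓝 0) := by
    refine Tendsto.div_atTop tendsto_const_nhds (Real.tendsto_sqrt_atTop.comp ?_)
    exact tendsto_atTop_add_const_right _ _ tendsto_natCast_atTop_atTop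
  have h4 := h3.add h2
  rw [add_zero] at h4
  refine h4.congr fun N => ?_
  have hN : (N : ℝ) + 1 ≠ 0 := by positivity
  simp only [Function.comp, add_assoc, Finset.sum_add_distrib, Finset.sum_const,
    Finset.card_range, nsmul_eq_mul]
  push_cast
  field_simp

/-- Convergence of the characteristic functions of linear combinations of the deviations. -/
lemma tendsto_charFun_lin (h : Admissible χ ρ) {k : ℕ} {r : ℝ} {t : ℕ → ℝ} (ht : Coeff k r t) :
    Tendsto (fun N : ℕ => ex χ ρ (N + 1) (fun l =>
        Complex.exp ((lin χ ρ k t l / √((N : ℝ) + 1) : ℝ) * Complex.I))) atTop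
      (𝓝 (Real.exp (-(quad k (asymCov (kap χ ρ) (limCov h)) t) / 2) : ℝ)) := by
  have hκ := h.kap_pos
  set S := asymCov (kap χ ρ) (limCov h) with hS
  have hr := ht.nonneg
  obtain ⟨W, C, hW, hC, hle⟩ := charRatio_sub_one_le h k (limCov h)
  set c : ℕ → ℝ := fun N => (√((N : ℝ) + 1))⁻¹ with hc
  have hc0 : ∀ N, 0 ≤ c N := fun N => by positivity
  have hc2 : ∀ N : ℕ, c N ^ 2 = ((N : ℝ) + 1)⁻¹ := fun N => by
    simp only [hc]
    rw [inv_pow, Real.sq_sqrt (by positivity)]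
  have hct : Tendsto c atTop (𝓝 0) := by
    refine (tendsto_inv_atTop_zero.comp (Real.tendsto_sqrt_atTop.comp ?_))
    exact tendsto_atTop_add_const_right _ _ tendsto_natCast_atTop_atTop
  have hratio : Tendsto (fun N : ℕ => ((N : ℝ) + kap χ ρ) * c N ^ 2) atTop (𝓝 1) := by
    have := (tendsto_add_kap_div (χ := χ) (ρ := ρ)).comp (tendsto_add_atTop_nat 1)
    refine this.congr fun N => ?_
    rw [hc2]
    simp only [Function.comp]
    push_cast
    ring
  have hG : Tendsto (fun N => charRatio χ ρ k S N (fun j => c N * t j)) atTop (𝓝 1) := by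
    rw [tendsto_iff_norm_sub_tendsto_zero]
    set η : ℕ → ℝ := fun N => ((N : ℝ) + 1)⁻¹ * ∑ M ∈ Finset.range (N + 1),
      (r / √((N : ℝ) + 1) + 1 / ((M : ℝ) + 1) + ex χ ρ (M + 1) (covDev χ ρ k (limCov h))) with hη
    have hηt : Tendsto η atTop (𝓝 0) := tendsto_cesaro_inv_sqrt (tendsto_ex_covDev h k) r
    have hcr : Tendsto (fun N => c N * r) atTop (𝓝 0) := by simpa using hct.mul_const r
    have hlim : Tendsto (fun N : ℕ => W * (c N * r)
        + Real.exp (C * r ^ 2 * (((N : ℝ) + kap χ ρ) * c N ^ 2)) * (C * r ^ 2 * η N))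
        atTop (𝓝 0) := by
      have := (hcr.const_mul W).add
        ((Real.continuous_exp.tendsto _).comp (hratio.const_mul (C * r ^ 2)) |>.mul
          (hηt.const_mul (C * r ^ 2)))
      simpa using this
    refine tendsto_of_tendsto_of_tendsto_of_le_of_le' tendsto_const_nhds hlim
      (Eventually.of_forall fun _ => norm_nonneg _) ?_
    filter_upwards [eventually_ge_atTop k, hcr.eventually (ge_mem_nhds one_pos)] with N hN hN1
    refine (hle N hN (c N * r) hN1 _ (ht.const_mul (hc0 N))).trans ?_
    have e1 : C * (N + kap χ ρ) * (c N * r) ^ 2 = C * r ^ 2 * (((N : ℝ) + kap χ ρ) * c N ^ 2) := by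
      ring
    have e2 : C * (c N * r) ^ 2 * ∑ M ∈ Finset.range N,
        (c N * r + 1 / ((M : ℝ) + 1) + ex χ ρ (M + 1) (covDev χ ρ k (limCov h)))
        ≤ C * r ^ 2 * η N := by
      have e3 : c N * r = r / √((N : ℝ) + 1) := by simp only [hc]; ring
      have e4 : C * r ^ 2 * η N = C * (c N * r) ^ 2 * ∑ M ∈ Finset.range (N + 1),
        (c N * r + 1 / ((M : ℝ) + 1) + ex χ ρ (M + 1) (covDev χ ρ k (limCov h))) := by
        rw [mul_pow, hc2, e3, hη]; ring
      rw [e4]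
      refine mul_le_mul_of_nonneg_left ?_ (by positivity)
      rw [Finset.sum_range_succ]
      have : 0 ≤ ex χ ρ (N + 1) (covDev χ ρ k (limCov h)) := ex_nonneg h (by omega) fun l _ _ =>
        Finset.sum_nonneg fun _ _ => Finset.sum_nonneg fun _ _ => abs_nonneg _
      have h5 : 0 ≤ c N * r := mul_nonneg (hc0 N) hr
      have h6 : 0 ≤ 1 / ((N : ℝ) + 1) := by positivity
      linarith
    rw [e1]
    have := mul_le_mul_of_nonneg_left e2
      (Real.exp_pos (C * r ^ 2 * (((N : ℝ) + kap χ ρ) * c N ^ 2))).le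
    linarith
  have hE : Tendsto (fun N : ℕ => ((Real.exp (-((((N : ℝ) + kap χ ρ) * c N ^ 2) * quad k S t) / 2)
      : ℝ) : ℂ)) atTop (𝓝 (Real.exp (-(quad k S t) / 2) : ℝ)) := by
    refine (Complex.continuous_ofReal.tendsto _).comp ((Real.continuous_exp.tendsto _).comp ?_)
    have := ((hratio.mul_const (quad k S t)).neg).div_const 2
    rwa [one_mul] at this
  have := hG.mul hE
  rw [one_mul] at this
  refine this.congr fun N => ?_
  unfold charRatio
  rw [quad_const_mul, mul_assoc, ← Complex.ofReal_mul, ← Real.exp_add]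
  have e0 : (N + kap χ ρ) * (c N ^ 2 * quad k S t) / 2
      + -(((N : ℝ) + kap χ ρ) * c N ^ 2 * quad k S t) / 2 = 0 := by ring
  rw [e0, Real.exp_zero, Complex.ofReal_one, mul_one]
  congr 1
  funext l
  congr 3
  unfold lin
  rw [Finset.sum_div]
  exact Finset.sum_congr rfl fun j _ => by simp only [hc]; ring

lemma quad_asymCov_nonneg (h : Admissible χ ρ) {k : ℕ} {r : ℝ} {t : ℕ → ℝ} (ht : Coeff k r t) :
    0 ≤ quad k (asymCov (kap χ ρ) (limCov h)) t := by
  have h1 : ‖((Real.exp (-(quad k (asymCov (kap χ ρ) (limCov h)) t) / 2) : ℝ) : ℂ)‖ ≤ 1 := by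
    refine le_of_tendsto (tendsto_charFun_lin h ht).norm (Eventually.of_forall fun N => ?_)
    refine (norm_ex_le h (by omega) _).trans (le_of_eq ?_)
    simp only [Complex.norm_exp_ofReal_mul_I]
    exact ex_const h (by omega) 1
  rw [Complex.norm_real, Real.norm_of_nonneg (Real.exp_pos _).le, Real.exp_le_one_iff] at h1
  linarith

lemma quad_succ_single (k : ℕ) (S : ℕ → ℕ → ℝ) (y : ℝ) :
    quad (k + 1) S (fun j => if j = k then y else 0) = y ^ 2 * S k k := by
  unfold quad
  rw [Finset.sum_eq_single k, Finset.sum_eq_single k]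
  · simp only [if_true]; ring
  · intro j _ hj; simp [hj]
  · intro hj; simp at hj
  · intro j _ hj; simp [hj]
  · intro hj; simp at hj

lemma quad_add_two_pair (k : ℕ) (S : ℕ → ℕ → ℝ) (x y : ℝ) :
    quad (k + 2) S (fun j => if j = k + 1 then y else if j = k then x else 0)
      = x ^ 2 * S k k + x * y * (S k (k + 1) + S (k + 1) k) + y ^ 2 * S (k + 1) (k + 1) := by
  have h0 : ∀ f : ℕ → ℝ, ∑ j ∈ Finset.range k,
      (if j = k + 1 then y else if j = k then x else 0) * f j = 0 := by
    intro f
    refine Finset.sum_eq_zero fun j hj => ?_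
    have := Finset.mem_range.1 hj
    rw [if_neg (by omega), if_neg (by omega), zero_mul]
  have h1 : ∀ i, ∑ j ∈ Finset.range (k + 2), (if j = k + 1 then y else if j = k then x else 0)
      * S i j = x * S i k + y * S i (k + 1) := by
    intro i
    rw [Finset.sum_range_succ, Finset.sum_range_succ, h0]
    simp
  unfold quad
  simp only [mul_assoc, ← Finset.mul_sum, h1]
  rw [Finset.sum_range_succ, Finset.sum_range_succ, h0]
  simp
  ring

lemma asymCov_self_pos (h : Admissible χ ρ) (k : ℕ) :
    0 < asymCov (kap χ ρ) (limCov h) k k := by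
  have hκ := h.kap_pos
  set S := asymCov (kap χ ρ) (limCov h) with hS
  have hΓ := limCov_self_pos h k
  have heq := asymCov_eq hκ (limCov h) k k
  rw [← hS] at heq
  rcases k with _ | k
  · simp only [down, add_zero] at heq
    push_cast at heq
    by_contra hneg
    push Not at hneg
    nlinarith
  · have hps : ∀ x y : ℝ, 0 ≤ x ^ 2 * S k k + x * y * (S k (k + 1) + S (k + 1) k)
        + y ^ 2 * S (k + 1) (k + 1) := by
      intro x y
      rw [← quad_add_two_pair]
      refine quad_asymCov_nonneg h (r := |x| + |y|) ⟨fun j hj => ?_, fun j => ?_⟩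
      · rw [if_neg (by omega), if_neg (by omega)]
      · have := abs_nonneg x
        have := abs_nonneg y
        split_ifs
        · linarith
        · linarith
        · rw [abs_zero]; linarith
    by_contra hneg
    push Not at hneg
    set b := S k (k + 1) + S (k + 1) k with hb
    have hb0 : b = 0 := by
      by_contra hb0
      have h1 := hps 1 (-((S k k + 1) / b))
      have h2 : (1 : ℝ) * (-((S k k + 1) / b)) * b = -(S k k + 1) := by field_simp
      have h3 : (-((S k k + 1) / b)) ^ 2 * S (k + 1) (k + 1) ≤ 0 :=
        mul_nonpos_of_nonneg_of_nonpos (sq_nonneg _) hneg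
      rw [h2] at h1
      linarith
    simp only [down] at heq
    have h4 : (1 + ((k + 1 : ℕ) + kap χ ρ) + ((k + 1 : ℕ) + kap χ ρ)) * S (k + 1) (k + 1)
        ≤ 0 := mul_nonpos_of_nonneg_of_nonpos (by positivity) hneg
    have h5 : (k + kap χ ρ) * S k (k + 1) + (k + kap χ ρ) * S (k + 1) k = 0 := by
      rw [← mul_add, ← hb, hb0, mul_zero]
    linarith

lemma exists_abs_ex_lin_le (h : Admissible χ ρ) (k : ℕ) :
    ∃ W : ℝ, ∀ N, k ≤ N → ∀ R t, Coeff k R t → |ex χ ρ (N + 1) (lin χ ρ k t)| ≤ W * R := by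
  refine ⟨ex χ ρ (k + 1) (fun l => ∑ j ∈ Finset.range k, |dev χ ρ l j|), fun N hN R => ?_⟩
  induction N, hN using Nat.le_induction with
  | base =>
    intro t ht
    refine (norm_ex_le h (by omega) (lin χ ρ k t)).trans ?_
    rw [mul_comm, ← ex_const_mul]
    exact ex_mono h (by omega) fun l _ _ => abs_lin_le ht l
  | succ N hN ih =>
    intro t ht
    have e : ex χ ρ (N + 1 + 1) (lin χ ρ k t)
        = ex χ ρ (N + 1) (lin χ ρ k (pullback (kap χ ρ) N t)) := by
      rw [ex_succ (by omega)]
      refine ex_congr h (by omega) fun l hl hln => ?_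
      rw [hl.avg_congr h fun x hx _ => hl.lin_snoc h hx (ht.supp k le_rfl), avg_add,
        hl.avg_const h, hl.avg_sum_noise h, add_zero, (by omega : l.length = N)]
    rw [e]
    exact ih _ (ht.pullback h.kap_pos hN)

end CentralLimit
end PATpaper

namespace PATpaper
open Filter Topology MeasureTheory

section Conclusion
variable {χ ρ : ℝ}

/-- The law of a functional of the parent list of the tree with `n` nodes. -/
noncomputable def law (χ ρ : ℝ) (n : ℕ) (F : List ℕ → ℝ) : Measure ℝ :=
  ∑ p : Omega n, ENNReal.ofReal (prob χ ρ (toList p)) • Measure.dirac (F (toList p))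

lemma integral_law {E : Type*} [NormedAddCommGroup E] [NormedSpace ℝ E] [CompleteSpace E]
    (h : Admissible χ ρ) {n : ℕ} (hn : 1 ≤ n) (F : List ℕ → ℝ) (f : ℝ → E) :
    ∫ x, f x ∂(law χ ρ n F) = ex χ ρ n (fun l => f (F l)) := by
  unfold law ex
  rw [integral_finsetSum_measure]
  · refine Finset.sum_congr rfl fun p _ => ?_
    rw [integral_smul_measure, integral_dirac, ENNReal.toReal_ofReal (prob_toList h hn p).1]
  · exact fun p _ => (integrable_dirac (by simp)).smul_measure ENNReal.ofReal_ne_top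

lemma isProbabilityMeasure_law (h : Admissible χ ρ) {n : ℕ} (hn : 1 ≤ n) (F : List ℕ → ℝ) :
    IsProbabilityMeasure (law χ ρ n F) := by
  constructor
  have h1 := ex_const h hn (1 : ℝ)
  unfold ex at h1
  simp only [smul_eq_mul, mul_one] at h1
  simp only [law, Measure.coe_finsetSum, Finset.sum_apply, Measure.smul_apply, measure_univ,
    smul_eq_mul, mul_one]
  rw [← ENNReal.ofReal_sum_of_nonneg fun p _ => (prob_toList h hn p).1, h1, ENNReal.ofReal_one]

/-- Convergence of characteristic functions implies convergence of expectations of bounded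
continuous functions. -/
lemma tendsto_ex_of_tendsto_charFun (h : Admissible χ ρ) (F : ℕ → List ℕ → ℝ) (v : NNReal)
    (hF : ∀ u : ℝ, Tendsto (fun N : ℕ => ex χ ρ (N + 1) (fun l =>
        Complex.exp ((u * F N l : ℝ) * Complex.I))) atTop
      (𝓝 (Real.exp (-(u ^ 2 * v) / 2) : ℝ)))
    (f : BoundedContinuousFunction ℝ ℝ) :
    Tendsto (fun N : ℕ => ex χ ρ (N + 1) (fun l => f (F N l))) atTop
      (𝓝 (∫ x, f x ∂(ProbabilityTheory.gaussianReal 0 v))) := by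
  have hp : ∀ N, IsProbabilityMeasure (law χ ρ (N + 1) (F N)) := fun N =>
    isProbabilityMeasure_law h (by omega) _
  let μ : ℕ → ProbabilityMeasure ℝ := fun N => ⟨law χ ρ (N + 1) (F N), hp N⟩
  let γ : ProbabilityMeasure ℝ := ⟨ProbabilityTheory.gaussianReal 0 v, inferInstance⟩
  have hμ : Tendsto μ atTop (𝓝 γ) := by
    refine ProbabilityMeasure.tendsto_of_tendsto_charFun fun u => ?_
    have hγ : charFun (γ : Measure ℝ) u = (Real.exp (-(u ^ 2 * v) / 2) : ℝ) := by
      change charFun (ProbabilityTheory.gaussianReal 0 v) u = _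
      rw [ProbabilityTheory.charFun_gaussianReal]
      push_cast
      congr 1
      ring
    rw [hγ]
    refine (hF u).congr fun N => ?_
    change _ = charFun (law χ ρ (N + 1) (F N)) u
    rw [charFun_apply_real, integral_law h (by omega)]
    push_cast
    rfl
  refine (ProbabilityMeasure.tendsto_iff_forall_integral_tendsto.1 hμ f).congr fun N => ?_
  exact integral_law h (by omega) _ _

lemma lin_single (k : ℕ) (u : ℝ) (l : List ℕ) :
    lin χ ρ (k + 1) (fun j => if j = k then u else 0) l = u * dev χ ρ l k := by
  unfold lin
  rw [Finset.sum_eq_single k]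
  · simp
  · intro j _ hj; simp [hj]
  · intro hj; simp at hj

lemma coeff_single (k : ℕ) (u : ℝ) : Coeff (k + 1) |u| (fun j => if j = k then u else 0) where
  supp j hj := if_neg (by omega)
  bound j := by split_ifs <;> simp

/-- A deviation, shifted by a negligible amount, is asymptotically normal. -/
lemma tendsto_ex_dev_add (h : Admissible χ ρ) (k : ℕ) (v : NNReal)
    (hv : (v : ℝ) = asymCov (kap χ ρ) (limCov h) k k) (a : ℕ → ℝ)
    (ha : Tendsto (fun N : ℕ => a N / √((N : ℝ) + 1)) atTop (𝓝 0))
    (f : BoundedContinuousFunction ℝ ℝ) :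
    Tendsto (fun N : ℕ => ex χ ρ (N + 1) (fun l =>
        f ((dev χ ρ l k + a N) / √((N : ℝ) + 1)))) atTop
      (𝓝 (∫ x, f x ∂(ProbabilityTheory.gaussianReal 0 v))) := by
  refine tendsto_ex_of_tendsto_charFun h
    (fun N l => (dev χ ρ l k + a N) / √((N : ℝ) + 1)) v (fun u => ?_) f
  have h1 := tendsto_charFun_lin h (coeff_single k u)
  rw [quad_succ_single, ← hv] at h1
  have h2 : Tendsto (fun N : ℕ => Complex.exp ((u * (a N / √((N : ℝ) + 1)) : ℝ) * Complex.I))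
      atTop (𝓝 1) := by
    have h3 : Continuous fun x : ℝ => Complex.exp ((u * x : ℝ) * Complex.I) := by fun_prop
    have h4 := (h3.tendsto 0).comp ha
    simpa [Function.comp_def] using h4
  have h5 := h2.mul h1
  rw [one_mul] at h5
  refine h5.congr fun N => ?_
  rw [← ex_const_mul]
  congr 1
  funext l
  rw [lin_single, ← Complex.exp_add]
  congr 1
  push_cast
  ring

lemma tendsto_div_sqrt_of_bounded {a : ℕ → ℝ} {C : ℝ} (ha : ∀ᶠ N in atTop, |a N| ≤ C) :
    Tendsto (fun N : ℕ => a N / √((N : ℝ) + 1)) atTop (𝓝 0) := by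
  have h1 : Tendsto (fun N : ℕ => √((N : ℝ) + 1)) atTop atTop :=
    Real.tendsto_sqrt_atTop.comp (tendsto_natCast_atTop_atTop.atTop_add tendsto_const_nhds)
  refine squeeze_zero_norm' ?_ (h1.const_div_atTop C)
  filter_upwards [ha] with N hN
  rw [norm_div, Real.norm_of_nonneg (Real.sqrt_nonneg _)]
  exact div_le_div_of_nonneg_right hN (Real.sqrt_nonneg _)

lemma countSize_toList {n : ℕ} (p : Omega (n + 1)) (k : ℕ) :
    (countSize (toList p) (n + 1) k : ℝ) = sizeCount (toList p) k := by
  have hl : (toList p).length = n := by rw [toList_length]; rfl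
  unfold countSize sizeCount desc
  rw [hl, Finset.card_filter]
  push_cast
  exact Finset.sum_congr rfl fun v _ => by congr

lemma expec_eq_ex {n : ℕ} {f : Omega n → ℝ} {F : List ℕ → ℝ} (hf : ∀ p, f p = F (toList p)) :
    expec χ ρ n f = ex χ ρ n F :=
  Finset.sum_congr rfl fun p _ => by rw [hf, smul_eq_mul]

lemma tendstoGaussP_of_eq_dev_add (h : Admissible χ ρ) (k : ℕ) (v : NNReal)
    (hv : (v : ℝ) = asymCov (kap χ ρ) (limCov h) k k) {a : ℕ → ℝ} {C : ℝ}
    (ha : ∀ᶠ N in atTop, |a N| ≤ C) {W : (n : ℕ) → Omega n → ℝ}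
    (hW : ∀ N (p : Omega (N + 1)),
      W (N + 1) p = (dev χ ρ (toList p) k + a N) / √((N : ℝ) + 1)) :
    TendstoGaussP χ ρ W v := by
  intro f
  refine (tendsto_add_atTop_iff_nat 1).1 ?_
  refine (tendsto_ex_dev_add h k v hv a (tendsto_div_sqrt_of_bounded ha) f).congr fun N => ?_
  exact (expec_eq_ex fun p => by rw [hW]).symm

lemma dev_toList {n : ℕ} (p : Omega (n + 1)) (k : ℕ) :
    dev χ ρ (toList p) k
      = countSize (toList p) (n + 1) (k + 1) - density χ ρ k * (n + kap χ ρ) := by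
  rw [countSize_toList, dev, toList_length, Nat.add_sub_cancel]

end Conclusion

end PATpaper

namespace PATpaper

/-- **Theorem (fringe subtrees with `k` nodes in linear preferential attachment
trees).** Let `w_j = χ j + ρ` with `ρ > 0`, `χ ∈ {−1, 0, 1}` (if `χ = −1` then
`ρ` is an integer `m ≥ 2`), and let `Y_{n,k}` be the number of fringe subtrees with
exactly `k ≥ 1` nodes in the linear preferential attachment tree `Λ_n` with `n`
nodes. Then `n^{-1/2}(Y_{n,k} - E Y_{n,k}) → N(0, σ_k²)` with `σ_k² > 0`, and also
`n^{-1/2}(Y_{n,k} - κ n/((k+κ−1)(k+κ))) → N(0, σ_k²)`, where `κ = ρ/(χ+ρ)`. -/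
theorem pat_fringe_count_clt (χ ρ : ℝ)
    (hχ : χ = -1 ∨ χ = 0 ∨ χ = 1) (hρ : 0 < ρ)
    (hint : χ = -1 → ∃ m : ℕ, 2 ≤ m ∧ ρ = m)
    (k : ℕ) (hk : 1 ≤ k) :
    ∃ σ2 : NNReal, 0 < σ2 ∧
      TendstoGaussP χ ρ (fun n p =>
        ((countSize (toList p) n k : ℝ)
            - expec χ ρ n (fun p' => (countSize (toList p') n k : ℝ))) / Real.sqrt n) σ2 ∧
      TendstoGaussP χ ρ (fun n p =>
        ((countSize (toList p) n k : ℝ)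
            - (ρ / (χ + ρ)) * (n : ℝ)
                / (((k : ℝ) + ρ / (χ + ρ) - 1) * ((k : ℝ) + ρ / (χ + ρ)))) / Real.sqrt n)
        σ2 := by
  have h : Admissible χ ρ := ⟨hχ, hρ, hint⟩
  obtain ⟨K, rfl⟩ : ∃ K, k = K + 1 := ⟨k - 1, by omega⟩
  have hσ := asymCov_self_pos h K
  obtain ⟨W, hW⟩ := exists_abs_ex_lin_le h (K + 1)
  refine ⟨⟨_, hσ.le⟩, hσ, ?_, ?_⟩
  · refine tendstoGaussP_of_eq_dev_add h K _ rfl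
      (a := fun N => -ex χ ρ (N + 1) (fun l => dev χ ρ l K)) (C := W * |1|) ?_ fun N p => ?_
    · filter_upwards [Filter.eventually_ge_atTop (K + 1)] with N hN
      have := hW N hN _ _ (coeff_single K 1)
      simp only [funext (lin_single (χ := χ) (ρ := ρ) K 1), one_mul] at this
      rwa [abs_neg]
    · have hE : expec χ ρ (N + 1) (fun p' => (countSize (toList p') (N + 1) (K + 1) : ℝ))
          = ex χ ρ (N + 1) (fun l => dev χ ρ l K) + density χ ρ K * (N + kap χ ρ) := by
        rw [← ex_const h (n := N + 1) (by omega) (density χ ρ K * (N + kap χ ρ)), ← ex_add]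
        refine expec_eq_ex fun p => ?_
        rw [dev_toList, sub_add_cancel]
      rw [hE, dev_toList]
      push_cast
      ring
  · refine tendstoGaussP_of_eq_dev_add h K _ rfl
      (a := fun _ => density χ ρ K * (kap χ ρ - 1)) (Filter.Eventually.of_forall fun _ => le_rfl)
      fun N p => ?_
    rw [dev_toList]
    simp only [density, kap]
    push_cast
    ring_nf

end PATpaper
end

section
/- Let A_k (m−1 ≤ k ≤ q) be the intensity matrix of the Pólya urn with types 𝒮_k decomposing the random m-ary search tree, where a_i denotes the activity (number of gaps) of type T_i. (i) If m ≥ 3, then (A_k)_{ii} = −a_i for every type i = 1,…,k; hence tr(A_k) = −Σ_{i=1}^k a_i. (ii) If m = 2, then (A_k)_{ii} = −a_i for every i except when T_i is the longest left path in 𝒮_k or the longest right path in 𝒮_k; if k ≥ 3 these two exceptional cases are distinct and (A_k)_{ii} = −a_i + 1 for them, while if k ≤ 2 the exceptional cases coincide and (A_k)_{ii} = −a_i + 2 for the single exceptional type; in all cases tr(A_k) = 2 − Σ_{i=1}^k a_i. -/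
open scoped BigOperators

namespace UrnMST

/-- The marked ordered tree underlying an `m`-ary search tree: a node either holds
`j` keys and has no children (`lf j`, with `j ≤ m - 2`; `lf 0` is an external node),
or is full, holding `m - 1` keys, and has `m` (possibly external) children. -/
inductive MTree (m : ℕ) : Type
  | lf : ℕ → MTree m
  | nd : (Fin m → MTree m) → MTree m

namespace MTree

/-- The number of gaps of a tree (the activity of the corresponding urn type):
a node holding `j ≤ m - 2` keys has `j + 1` gaps, full nodes have none. -/
def gaps {m : ℕ} : MTree m → ℕ
  | lf j => j + 1
  | nd c => ∑ i, gaps (c i)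

/-- The list of all trees obtained by inserting one new key into one of the gaps of
the given tree (one entry for each gap). -/
def insertions {m : ℕ} : MTree m → List (MTree m)
  | lf j => List.replicate (j + 1) (if j + 2 < m then lf (j + 1) else nd (fun _ => lf 0))
  | nd c => (List.finRange m).flatMap
      (fun i => (insertions (c i)).map (fun t => nd (Function.update c i t)))

end MTree

/-- `Grows m t t'` means that `t'` can be obtained from `t` by adding keys
(the partial order `⪯` on `m`-ary search trees). -/
def Grows (m : ℕ) : MTree m → MTree m → Prop :=
  Relation.ReflTransGen (fun a b => b ∈ MTree.insertions a)

open Classical in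
/-- Decompose a tree with respect to the set `S` of living types (a node is living
if its fringe subtree lies in `S`, and descendants of living nodes are living), and
count the number of components of type `T`. -/
noncomputable def decompCount {m : ℕ} (S : Set (MTree m)) (T : MTree m) : MTree m → ℕ
  | MTree.lf j => if MTree.lf j ∈ S ∧ MTree.lf j = T then 1 else 0
  | MTree.nd c => if MTree.nd c ∈ S then (if MTree.nd c = T then 1 else 0)
      else ∑ i, decompCount S T (c i)

/-- The intensity matrix `A_k = (a_j E ξ_{ji})_{i,j}` of the Pólya urn with types
`𝒮_k = {T_1, …, T_k}` (given by the enumeration `τ` of `𝒮 = 𝒮_q`): a ball of type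
`T_j` is drawn with probability proportional to its activity `a_j = gaps T_j`, a new
key is inserted into a uniformly chosen gap of it, and the result is re-decomposed
with respect to `𝒮_k`; the drawn ball counts as removed. -/
noncomputable def intensity {m q : ℕ} (τ : Fin q → MTree m) (k : ℕ) (hk : k ≤ q) :
    Matrix (Fin k) (Fin k) ℝ :=
  Matrix.of fun i j =>
    (((MTree.insertions (τ (Fin.castLE hk j))).map
        (fun t => (decompCount (Set.range fun s : Fin k => τ (Fin.castLE hk s))
          (τ (Fin.castLE hk i)) t : ℝ))).sum)
      - (if i = j then (MTree.gaps (τ (Fin.castLE hk j)) : ℝ) else 0)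

/-- For `m = 2`: the left path with `n` internal nodes. -/
def leftPath (m : ℕ) : ℕ → MTree m
  | 0 => MTree.lf 0
  | n + 1 => MTree.nd (fun i => if (i : ℕ) = 0 then leftPath m n else MTree.lf 0)

/-- For `m = 2`: the right path with `n` internal nodes. -/
def rightPath (m : ℕ) : ℕ → MTree m
  | 0 => MTree.lf 0
  | n + 1 => MTree.nd (fun i => if (i : ℕ) = m - 1 then rightPath m n else MTree.lf 0)

/-- `t` is the longest left path belonging to `S`. -/
def MaxLeft {m : ℕ} (S : Set (MTree m)) (t : MTree m) : Prop :=
  ∃ n, t = leftPath m n ∧ leftPath m n ∈ S ∧ leftPath m (n + 1) ∉ S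

/-- `t` is the longest right path belonging to `S`. -/
def MaxRight {m : ℕ} (S : Set (MTree m)) (t : MTree m) : Prop :=
  ∃ n, t = rightPath m n ∧ rightPath m n ∈ S ∧ rightPath m (n + 1) ∉ S

end UrnMST

namespace UrnMST

open MTree

namespace MTree

/-- The number of keys stored in a tree. -/
def keys {m : ℕ} : MTree m → ℕ
  | lf j => j
  | nd c => (m - 1) + ∑ i, keys (c i)

lemma keys_child_le {m : ℕ} (c : Fin m → MTree m) (i : Fin m) :
    (m - 1) + keys (c i) ≤ keys (nd c) := by
  rw [keys]
  have := Finset.single_le_sum (f := fun i => keys (c i)) (fun _ _ => Nat.zero_le _)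
    (Finset.mem_univ i)
  simpa using this

lemma mem_insertions_nd {m : ℕ} {c : Fin m → MTree m} {t : MTree m} :
    t ∈ insertions (nd c) ↔
      ∃ i, ∃ u ∈ insertions (c i), nd (Function.update c i u) = t := by
  simp [insertions]

lemma mem_insertions_lf {m j : ℕ} {t : MTree m} :
    t ∈ insertions (lf j) ↔ t = if j + 2 < m then lf (j + 1) else nd (fun _ => lf 0) := by
  simp [insertions]

lemma keys_le_of_mem_insertions {m : ℕ} (t : MTree m) :
    ∀ u ∈ insertions t, keys u ≤ keys t + 1 := by
  induction t with
  | lf j =>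
    intro u hu
    rw [mem_insertions_lf] at hu
    split_ifs at hu with h
    · simp [hu, keys]
    · simp only [hu, keys, Finset.sum_const_zero]
      omega
  | nd c ih =>
    intro u hu
    obtain ⟨i, v, hv, rfl⟩ := mem_insertions_nd.1 hu
    have := ih i v hv
    simp only [keys]
    rw [← Finset.add_sum_erase _ _ (Finset.mem_univ i),
      ← Finset.add_sum_erase _ (fun j => keys (c j)) (Finset.mem_univ i)]
    have h2 : ∑ x ∈ Finset.univ.erase i, keys (Function.update c i v x)
        = ∑ x ∈ Finset.univ.erase i, keys (c x) :=
      Finset.sum_congr rfl fun x hx => by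
        rw [Function.update_of_ne (Finset.ne_of_mem_erase hx)]
    rw [h2]
    simp only [Function.update_self]
    omega

lemma notMem_insertions_self {m : ℕ} (t : MTree m) : t ∉ insertions t := by
  induction t with
  | lf j =>
    rw [mem_insertions_lf]
    split_ifs <;> simp
  | nd c ih =>
    rw [mem_insertions_nd]
    rintro ⟨i, u, hu, h⟩
    have h1 : Function.update c i u i = c i := by
      rw [MTree.nd.inj h]
    rw [Function.update_self] at h1
    exact ih i (h1 ▸ hu)

lemma eq_lf_zero_of_keys_eq_zero {m : ℕ} (hm : 2 ≤ m) {t : MTree m} (h : keys t = 0) :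
    t = lf 0 := by
  cases t with
  | lf j => simpa [keys] using h
  | nd c => simp only [keys] at h; omega

end MTree

lemma decompCount_eq_zero {m : ℕ} (S : Set (MTree m)) (T t : MTree m)
    (h : keys t < keys T) : decompCount S T t = 0 := by
  induction t with
  | lf j =>
    have : lf j ≠ T := by rintro rfl; exact lt_irrefl _ h
    simp [decompCount, this]
  | nd c ih =>
    have : nd c ≠ T := by rintro rfl; exact lt_irrefl _ h
    have h0 : ∀ i, decompCount S T (c i) = 0 := fun i =>
      ih i (lt_of_le_of_lt (by have := keys_child_le c i; omega) h)
    simp [decompCount, this, h0]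

open Classical in
lemma decompCount_of_keys_le {m : ℕ} (hm : 2 ≤ m) {S : Set (MTree m)} {T : MTree m}
    (hT : T ∈ S) (t : MTree m) (h : keys t ≤ keys T) :
    decompCount S T t = if t = T then 1 else 0 := by
  cases t with
  | lf j =>
    rw [decompCount]
    refine if_congr ⟨fun h => h.2, fun h => ⟨h ▸ hT, h⟩⟩ rfl rfl
  | nd c =>
    rw [decompCount]
    split_ifs with h1 h2 h2
    · rfl
    · rfl
    · exact absurd (h2 ▸ hT) h1
    · exact Finset.sum_eq_zero fun i _ => decompCount_eq_zero _ _ _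
        (by have := keys_child_le c i; omega)

lemma decompCount_insertions_eq_zero {m : ℕ} (hm : 3 ≤ m) (S : Set (MTree m)) (T : MTree m) :
    ∀ t ∈ insertions T, decompCount S T t = 0 := by
  intro t ht
  have hne : t ≠ T := by rintro rfl; exact notMem_insertions_self _ ht
  cases t with
  | lf j => simp [decompCount, hne]
  | nd c' =>
    have hk := keys_le_of_mem_insertions T _ ht
    have : ∀ i, decompCount S T (c' i) = 0 := by
      intro i
      cases T with
      | lf j =>
        rw [mem_insertions_lf] at ht
        split_ifs at ht with h
        obtain rfl := MTree.nd.inj ht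
        have : j ≠ 0 := by omega
        simp [decompCount, this.symm]
      | nd c =>
        refine decompCount_eq_zero _ _ _ ?_
        have := keys_child_le c' i
        omega
    simp [decompCount, hne, this]

/-- The binary tree whose child on side `s` is `t` and whose other child is external. -/
def graft (s : Fin 2) (t : MTree 2) : MTree 2 :=
  nd (Function.update (fun _ => lf 0) s t)

/-- The path with `n` internal nodes going in direction `s`. -/
def path (s : Fin 2) : ℕ → MTree 2
  | 0 => lf 0
  | n + 1 => graft s (path s n)

/-- `t` is the longest path in direction `s` belonging to `S`. -/
def MaxPath (S : Set (MTree 2)) (s : Fin 2) (t : MTree 2) : Prop :=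
  ∃ n, t = path s n ∧ path s n ∈ S ∧ path s (n + 1) ∉ S

lemma leftPath_eq_path (n : ℕ) : leftPath 2 n = path 0 n := by
  induction n with
  | zero => rfl
  | succ n ih =>
    rw [leftPath, path, graft, ih]
    congr 1
    funext i
    fin_cases i <;> simp [Function.update]

lemma rightPath_eq_path (n : ℕ) : rightPath 2 n = path 1 n := by
  induction n with
  | zero => rfl
  | succ n ih =>
    rw [rightPath, path, graft, ih]
    congr 1
    funext i
    fin_cases i <;> simp [Function.update]

lemma maxLeft_iff {S : Set (MTree 2)} {t : MTree 2} : MaxLeft S t ↔ MaxPath S 0 t := by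
  simp only [MaxLeft, MaxPath, leftPath_eq_path]

lemma maxRight_iff {S : Set (MTree 2)} {t : MTree 2} : MaxRight S t ↔ MaxPath S 1 t := by
  simp only [MaxRight, MaxPath, rightPath_eq_path]

lemma keys_graft (s : Fin 2) (t : MTree 2) : keys (graft s t) = keys t + 1 := by
  fin_cases s <;> simp [graft, keys, Function.update, add_comm]

lemma keys_path (s : Fin 2) (n : ℕ) : keys (path s n) = n := by
  induction n with
  | zero => rfl
  | succ n ih => rw [path, keys_graft, ih]

lemma path_injective (s : Fin 2) : Function.Injective (path s) := fun a b h => by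
  rw [← keys_path s a, h, keys_path]

lemma graft_lf_zero (s : Fin 2) : graft s (lf 0) = nd (fun _ => lf 0) := by
  simp [graft]

lemma graft_inj {s : Fin 2} {t u : MTree 2} : graft s t = graft s u ↔ t = u := by
  refine ⟨fun h => ?_, fun h => h ▸ rfl⟩
  simpa using congrFun (MTree.nd.inj h) s

lemma path_one (s s' : Fin 2) : path s 1 = path s' 1 := by
  simp [path, graft_lf_zero]

lemma lf_notMem_insertions (j : ℕ) (t : MTree 2) : lf j ∉ insertions t := by
  cases t with
  | lf i => simp [mem_insertions_lf]
  | nd c => simp [mem_insertions_nd]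

lemma graft_mem_insertions_graft {s : Fin 2} {t u : MTree 2} (h : u ∈ insertions t) :
    graft s u ∈ insertions (graft s t) :=
  mem_insertions_nd.2 ⟨s, u, by simpa using h, by simp [graft]⟩

lemma path_succ_mem_insertions (s : Fin 2) (n : ℕ) :
    path s (n + 1) ∈ insertions (path s n) := by
  induction n with
  | zero => simp [path, mem_insertions_lf, graft_lf_zero]
  | succ n ih => exact graft_mem_insertions_graft ih

lemma exists_graft_eq {c : Fin 2 → MTree 2} {s : Fin 2} {u t : MTree 2}
    (h : nd (Function.update c s u) = graft s t) : nd c = graft s (c s) := by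
  have h' := MTree.nd.inj h
  rw [graft]
  congr 1
  funext i
  by_cases hi : i = s
  · subst hi; simp
  · have := congrFun h' i
    simpa [Function.update_of_ne hi] using this

open Classical in
lemma count_graft_insertions (s : Fin 2) (T : MTree 2) :
    (insertions T).count (graft s T) = if ∃ n, T = path s n then 1 else 0 := by
  induction T with
  | lf j =>
    by_cases hj : j = 0
    · subst hj
      rw [if_pos ⟨0, rfl⟩]
      simp [insertions, graft_lf_zero]
    · rw [if_neg, List.count_eq_zero]
      · rw [mem_insertions_lf, if_neg (by omega), ← graft_lf_zero s, graft_inj]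
        simpa using hj
      · rintro ⟨_ | n, h⟩
        · simp [path, hj] at h
        · simp [path, graft] at h
  | nd c ih =>
    have hother : ∀ i ≠ s, ((insertions (c i)).map
        (fun t => nd (Function.update c i t))).count (graft s (nd c)) = 0 := by
      intro i hi
      rw [List.count_eq_zero, List.mem_map]
      rintro ⟨t, ht, h⟩
      have := congrFun (MTree.nd.inj h) i
      rw [Function.update_self, Function.update_of_ne hi] at this
      exact lf_notMem_insertions 0 _ (this ▸ ht)
    have hsum : (insertions (nd c)).count (graft s (nd c)) = ((insertions (c s)).map
        (fun t => nd (Function.update c s t))).count (graft s (nd c)) := by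
      have : (insertions (nd c)).count (graft s (nd c)) = ∑ i : Fin 2, ((insertions (c i)).map
          (fun t => nd (Function.update c i t))).count (graft s (nd c)) := by
        simp [insertions, List.finRange_succ, List.count_append]
      rw [this]
      exact Finset.sum_eq_single s (fun i _ hi => hother i hi) (by simp)
    rw [hsum]
    by_cases hc : nd c = graft s (c s)
    · have hup : (fun t => nd (Function.update c s t)) = graft s := by
        funext t
        rw [graft] at hc
        rw [MTree.nd.inj hc]
        simp [graft]
      rw [hup, List.count_map_of_injective _ _ (fun a b h => graft_inj.1 h)]
      have hiff : (∃ n, nd c = path s n) ↔ ∃ n, c s = path s n := by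
        constructor
        · rintro ⟨_ | n, h⟩
          · simp [path] at h
          · rw [hc, path, graft_inj] at h
            exact ⟨n, h⟩
        · rintro ⟨n, h⟩
          exact ⟨n + 1, by rw [hc, path, h]⟩
      rw [if_congr hiff rfl rfl, ← ih s, ← hc]
    · rw [if_neg, List.count_eq_zero, List.mem_map]
      · rintro ⟨t, -, h⟩
        exact hc (exists_graft_eq h)
      · rintro ⟨_ | n, h⟩
        · simp [path] at h
        · exact hc (exists_graft_eq (t := path s n) (u := c s) (by simpa [path] using h))

lemma eq_graft_iff {s : Fin 2} {c : Fin 2 → MTree 2} {T : MTree 2}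
    (h : keys (nd c) ≤ keys T + 1) : nd c = graft s T ↔ c s = T := by
  constructor
  · intro h
    rw [MTree.nd.inj h, Function.update_self]
  · rintro rfl
    have hz : ∀ i ≠ s, c i = lf 0 := by
      intro i hi
      apply eq_lf_zero_of_keys_eq_zero le_rfl
      simp only [keys, Fin.sum_univ_two] at h
      fin_cases s <;> fin_cases i <;> simp_all <;> omega
    rw [graft]
    congr 1
    funext i
    by_cases hi : i = s
    · subst hi; simp
    · rw [Function.update_of_ne hi, hz i hi]

open Classical in
lemma decompCount_of_mem_insertions {S : Set (MTree 2)} {T t : MTree 2} (hT : T ∈ S)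
    (ht : t ∈ insertions T) :
    decompCount S T t = ∑ s : Fin 2, if t = graft s T ∧ graft s T ∉ S then 1 else 0 := by
  have hk := keys_le_of_mem_insertions T _ ht
  cases t with
  | lf j => exact absurd ht (lf_notMem_insertions _ _)
  | nd c =>
    have hne : nd c ≠ T := fun h => notMem_insertions_self _ (h ▸ ht)
    rw [decompCount]
    by_cases hS : nd c ∈ S
    · rw [if_pos hS, if_neg hne]
      refine (Finset.sum_eq_zero fun s _ => if_neg ?_).symm
      rintro ⟨h1, h2⟩
      exact h2 (h1 ▸ hS)
    · rw [if_neg hS]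
      refine Finset.sum_congr rfl fun s _ => ?_
      rw [decompCount_of_keys_le le_rfl hT _ (by have := keys_child_le c s; omega)]
      refine if_congr ?_ rfl rfl
      rw [← eq_graft_iff hk]
      exact ⟨fun h => ⟨h, h ▸ hS⟩, fun h => h.1⟩

lemma maxPath_iff {S : Set (MTree 2)} {s : Fin 2} {T : MTree 2} (hT : T ∈ S) :
    MaxPath S s T ↔ (∃ n, T = path s n) ∧ graft s T ∉ S := by
  constructor
  · rintro ⟨n, rfl, h1, h2⟩
    exact ⟨⟨n, rfl⟩, h2⟩
  · rintro ⟨⟨n, rfl⟩, h2⟩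
    exact ⟨n, rfl, hT, h2⟩

lemma sum_map_ite_eq_count {α : Type*} [DecidableEq α] (a : α) (l : List α) :
    (l.map fun x => if x = a then 1 else 0).sum = l.count a := by
  induction l with
  | nil => rfl
  | cons b l ih => simp [List.count_cons, ih, add_comm]

open Classical in
lemma sum_decompCount_insertions {S : Set (MTree 2)} {T : MTree 2} (hT : T ∈ S) :
    ((insertions T).map (decompCount S T)).sum
      = ∑ s : Fin 2, if MaxPath S s T then 1 else 0 := by
  have hside : ∀ s : Fin 2, ((insertions T).map
      (fun t => if t = graft s T ∧ graft s T ∉ S then 1 else 0)).sum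
      = if MaxPath S s T then 1 else 0 := by
    intro s
    rw [if_congr (maxPath_iff hT) rfl rfl]
    by_cases h : graft s T ∈ S
    · simp [h]
    · simp only [h, not_false_eq_true, and_true]
      rw [← count_graft_insertions, sum_map_ite_eq_count]
  rw [List.map_congr_left fun t ht => decompCount_of_mem_insertions hT ht]
  simp only [Fin.sum_univ_two, List.sum_map_add, hside]

lemma eq_lf_or_grows_path_one {t : MTree 2} (h : Grows 2 (lf 0) t) :
    t = lf 0 ∨ Grows 2 (path 0 1) t := by
  rcases Relation.ReflTransGen.cases_head h with h | ⟨u, hu, h⟩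
  · exact Or.inl h.symm
  · rw [mem_insertions_lf, if_neg (by omega)] at hu
    subst hu
    rw [path, path, graft_lf_zero]
    exact Or.inr h

lemma grows_path (s : Fin 2) (n : ℕ) : Grows 2 (lf 0) (path s n) := by
  induction n with
  | zero => exact Relation.ReflTransGen.refl
  | succ n ih => exact ih.tail (path_succ_mem_insertions s n)

lemma eq_or_grows_path_two {t : MTree 2} (h : Grows 2 (lf 0) t) :
    t = lf 0 ∨ t = path 0 1 ∨ ∃ s, Grows 2 (path s 2) t := by
  rcases eq_lf_or_grows_path_one h with h | h
  · exact Or.inl h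
  rcases Relation.ReflTransGen.cases_head h with h | ⟨u, hu, h⟩
  · exact Or.inr (Or.inl h.symm)
  · refine Or.inr (Or.inr ?_)
    rw [path, path, graft_lf_zero, mem_insertions_nd] at hu
    obtain ⟨s, v, hv, rfl⟩ := hu
    rw [mem_insertions_lf, if_neg (by omega)] at hv
    subst hv
    refine ⟨s, ?_⟩
    rw [path, path, path, graft_lf_zero]
    exact h

lemma eq_of_path_eq_path {a b : ℕ} (h : path 0 a = path 1 b) : a = b ∧ a ≤ 1 := by
  have hab : a = b := by rw [← keys_path 0 a, h, keys_path]
  subst hab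
  refine ⟨rfl, ?_⟩
  by_contra! ha
  obtain ⟨n, rfl⟩ : ∃ n, a = n + 2 := ⟨a - 2, by omega⟩
  have := congrArg keys (congrFun (MTree.nd.inj h) 0)
  simp [Function.update, keys, path, keys_graft] at this

/-- A set of binary search trees that is closed downwards among all of them. -/
structure IsDownSet (S : Set (MTree 2)) : Prop where
  grows : ∀ t ∈ S, Grows 2 (lf 0) t
  down : ∀ a, ∀ t ∈ S, Grows 2 (lf 0) a → Grows 2 a t → a ∈ S

namespace IsDownSet

variable {S : Set (MTree 2)}

lemma path_mem_of_le (hS : IsDownSet S) {s : Fin 2} {a b : ℕ} (hab : a ≤ b)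
    (h : path s b ∈ S) : path s a ∈ S := by
  induction b, hab using Nat.le_induction with
  | base => exact h
  | succ b _ ih =>
    exact ih (hS.down _ _ h (grows_path s b)
      (Relation.ReflTransGen.single (path_succ_mem_insertions s b)))

lemma existsUnique_maxPath (hS : IsDownSet S) (hfin : S.Finite) (h0 : lf 0 ∈ S) (s : Fin 2) :
    ∃! t, t ∈ S ∧ MaxPath S s t := by
  classical
  have hex : ∃ n, path s n ∉ S := by
    by_contra! h
    exact Set.infinite_range_of_injective (path_injective s)
      (hfin.subset (Set.range_subset_iff.2 h))
  have hspec := Nat.find_spec hex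
  obtain ⟨n, hn⟩ : ∃ n, Nat.find hex = n + 1 := by
    refine Nat.exists_eq_succ_of_ne_zero fun h => ?_
    rw [h] at hspec
    exact hspec h0
  have hmem : path s n ∈ S := not_not.1 (Nat.find_min hex (by omega))
  rw [hn] at hspec
  refine ⟨path s n, ⟨hmem, n, rfl, hmem, hspec⟩, ?_⟩
  rintro _ ⟨-, k, rfl, hk, hk'⟩
  have h1 : ¬ n + 1 ≤ k := fun h => hspec (hS.path_mem_of_le h hk)
  have h2 : ¬ k + 1 ≤ n := fun h => hk' (hS.path_mem_of_le h hmem)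
  rw [show k = n by omega]

lemma ncard_le_two (hS : IsDownSet S) (h : ∀ s, path s 2 ∉ S) : S.ncard ≤ 2 := by
  have hsub : S ⊆ {lf 0, path 0 1} := by
    intro t ht
    rcases eq_or_grows_path_two (hS.grows t ht) with h' | h' | ⟨s, hs⟩
    · exact Or.inl h'
    · exact Or.inr h'
    · exact absurd (hS.down _ _ ht (grows_path s 2) hs) (h s)
  exact (Set.ncard_le_ncard hsub).trans ((Set.ncard_insert_le _ _).trans (by simp))

lemma not_maxPath_and (hS : IsDownSet S) (hcard : 3 ≤ S.ncard) (t : MTree 2) :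
    ¬ (MaxPath S 0 t ∧ MaxPath S 1 t) := by
  rintro ⟨⟨a, rfl, -, ha⟩, ⟨b, hab, -, hb⟩⟩
  obtain ⟨rfl, h1⟩ := eq_of_path_eq_path hab
  have := hS.ncard_le_two (fun s => by
    fin_cases s
    · exact fun h => ha (hS.path_mem_of_le (by omega) h)
    · exact fun h => hb (hS.path_mem_of_le (by omega) h))
  omega

lemma le_one_of_path_mem (hS : IsDownSet S) (hfin : S.Finite) (hcard : S.ncard ≤ 2)
    {s : Fin 2} {n : ℕ} (h : path s n ∈ S) : n ≤ 1 := by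
  by_contra! hn
  have hsub : path s '' Set.Iio 3 ⊆ S := by
    rintro _ ⟨i, hi, rfl⟩
    exact hS.path_mem_of_le (by have := Set.mem_Iio.1 hi; omega) h
  have := Set.ncard_le_ncard hsub hfin
  rw [Set.ncard_image_of_injective _ (path_injective s)] at this
  simp at this
  omega

lemma maxPath_congr (hS : IsDownSet S) (hfin : S.Finite) (hcard : S.ncard ≤ 2)
    (s s' : Fin 2) {t : MTree 2} (h : MaxPath S s t) : MaxPath S s' t := by
  have hpath : ∀ n ≤ 1, path s n = path s' n := by
    intro n hn
    interval_cases n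
    · rfl
    · exact path_one s s'
  obtain ⟨n, rfl, h1, h2⟩ := h
  have hn := hS.le_one_of_path_mem hfin hcard h1
  refine ⟨n, hpath n hn, hpath n hn ▸ h1, fun h3 => h2 ?_⟩
  rwa [hpath _ (hS.le_one_of_path_mem hfin hcard h3)]

end IsDownSet

/-- **Proposition (diagonal entries and trace of the intensity matrices `A_k`).**
Let `𝒮 = {T_1, …, T_q}` (enumerated compatibly with `⪯` by `τ`) be a down-set of
`m`-ary search trees containing all single-node trees, and for `m − 1 ≤ k ≤ q` let
`A_k` be the intensity matrix of the Pólya urn with types `𝒮_k = {T_1, …, T_k}`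
decomposing the random `m`-ary search tree, with activities `a_i = gaps T_i`.
(i) If `m ≥ 3` then `(A_k)_{ii} = −a_i` for every `i`, and `tr A_k = −Σ a_i`.
(ii) If `m = 2` then `(A_k)_{ii} = −a_i` for every `i` except when `T_i` is the
longest left path or the longest right path in `𝒮_k`; for `k ≥ 3` the two
exceptional cases are distinct and `(A_k)_{ii} = −a_i + 1` for them, while for
`k ≤ 2` they coincide and `(A_k)_{ii} = −a_i + 2`; in all cases
`tr A_k = 2 − Σ a_i`. -/
theorem intensity_diagonal (m q : ℕ) (τ : Fin q → MTree m)
    (hinj : Function.Injective τ)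
    (hvalid : ∀ i, Grows m (MTree.lf 0) (τ i))
    (hdown : ∀ (a : MTree m) (i : Fin q),
      Grows m (MTree.lf 0) a → Grows m a (τ i) → a ∈ Set.range τ)
    (hsingle : ∀ j, j ≤ m - 2 → MTree.lf j ∈ Set.range τ)
    (hcompat : ∀ i j : Fin q, Grows m (τ i) (τ j) → i ≤ j)
    (k : ℕ) (hk : k ≤ q) :
    (3 ≤ m → m - 1 ≤ k →
      (∀ i : Fin k,
        intensity τ k hk i i = -(MTree.gaps (τ (Fin.castLE hk i)) : ℝ)) ∧
      (intensity τ k hk).trace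
        = -∑ i : Fin k, (MTree.gaps (τ (Fin.castLE hk i)) : ℝ))
    ∧
    (m = 2 → 1 ≤ k →
      (∀ i : Fin k,
        ¬ MaxLeft (Set.range fun s : Fin k => τ (Fin.castLE hk s)) (τ (Fin.castLE hk i)) →
        ¬ MaxRight (Set.range fun s : Fin k => τ (Fin.castLE hk s)) (τ (Fin.castLE hk i)) →
          intensity τ k hk i i = -(MTree.gaps (τ (Fin.castLE hk i)) : ℝ)) ∧
      (3 ≤ k →
        (∀ i : Fin k,
          ¬ (MaxLeft (Set.range fun s : Fin k => τ (Fin.castLE hk s)) (τ (Fin.castLE hk i)) ∧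
             MaxRight (Set.range fun s : Fin k => τ (Fin.castLE hk s)) (τ (Fin.castLE hk i)))) ∧
        (∀ i : Fin k,
          (MaxLeft (Set.range fun s : Fin k => τ (Fin.castLE hk s)) (τ (Fin.castLE hk i)) ∨
           MaxRight (Set.range fun s : Fin k => τ (Fin.castLE hk s)) (τ (Fin.castLE hk i))) →
            intensity τ k hk i i = -(MTree.gaps (τ (Fin.castLE hk i)) : ℝ) + 1)) ∧
      (k ≤ 2 →
        (∀ i : Fin k,
          MaxLeft (Set.range fun s : Fin k => τ (Fin.castLE hk s)) (τ (Fin.castLE hk i)) ↔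
          MaxRight (Set.range fun s : Fin k => τ (Fin.castLE hk s)) (τ (Fin.castLE hk i))) ∧
        (∀ i : Fin k,
          MaxLeft (Set.range fun s : Fin k => τ (Fin.castLE hk s)) (τ (Fin.castLE hk i)) →
            intensity τ k hk i i = -(MTree.gaps (τ (Fin.castLE hk i)) : ℝ) + 2)) ∧
      (intensity τ k hk).trace
        = 2 - ∑ i : Fin k, (MTree.gaps (τ (Fin.castLE hk i)) : ℝ)) := by
  classical
  set S : Set (MTree m) := Set.range fun s : Fin k => τ (Fin.castLE hk s) with hSdef
  have hginj : Function.Injective fun s : Fin k => τ (Fin.castLE hk s) :=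
    hinj.comp (Fin.castLE_injective hk)
  have hdiag : ∀ i : Fin k, intensity τ k hk i i
      = ((((insertions (τ (Fin.castLE hk i))).map
          (decompCount S (τ (Fin.castLE hk i)))).sum : ℕ) : ℝ)
        - (gaps (τ (Fin.castLE hk i)) : ℝ) := by
    intro i
    simp only [intensity, Matrix.of_apply, if_true, Nat.cast_list_sum, List.map_map]
    rfl
  refine ⟨fun hm _ => ?_, ?_⟩
  · have hentry : ∀ i : Fin k,
        intensity τ k hk i i = -(gaps (τ (Fin.castLE hk i)) : ℝ) := by
      intro i
      rw [hdiag, List.map_congr_left (decompCount_insertions_eq_zero hm S _)]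
      simp
    refine ⟨hentry, ?_⟩
    simp [Matrix.trace, hentry]
  · rintro rfl hk1
    have hfin : S.Finite := Set.finite_range _
    have hcard : S.ncard = k := by
      rw [hSdef, ← Set.image_univ, Set.ncard_image_of_injective _ hginj, Set.ncard_univ,
        Nat.card_fin]
    have hS : IsDownSet S := by
      refine ⟨?_, ?_⟩
      · rintro _ ⟨i, rfl⟩
        exact hvalid _
      · rintro a _ ⟨i, rfl⟩ ha hai
        obtain ⟨j, rfl⟩ := hdown a _ ha hai
        have hji : (j : ℕ) ≤ i := hcompat _ _ hai
        exact ⟨⟨j, by omega⟩, rfl⟩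
    have h0 : lf 0 ∈ S :=
      hS.down _ (τ (Fin.castLE hk ⟨0, hk1⟩)) ⟨_, rfl⟩ Relation.ReflTransGen.refl (hvalid _)
    have hentry : ∀ i : Fin k, intensity τ k hk i i
        = (∑ s : Fin 2, if MaxPath S s (τ (Fin.castLE hk i)) then (1 : ℝ) else 0)
          - (gaps (τ (Fin.castLE hk i)) : ℝ) := by
      intro i
      rw [hdiag, sum_decompCount_insertions (Set.mem_range_self i)]
      push_cast
      rfl
    simp only [maxLeft_iff, maxRight_iff]
    refine ⟨?_, fun hk3 => ?_, fun hk2 => ?_, ?_⟩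
    · intro i h1 h2
      simp [hentry, h1, h2]
    · have hnot : ∀ t, ¬ (MaxPath S 0 t ∧ MaxPath S 1 t) :=
        hS.not_maxPath_and (hcard ▸ hk3)
      refine ⟨fun i => hnot _, fun i hi => ?_⟩
      have := hnot (τ (Fin.castLE hk i))
      rcases hi with h | h
      · rw [hentry, Fin.sum_univ_two, if_pos h, if_neg fun h' => this ⟨h, h'⟩]
        ring
      · rw [hentry, Fin.sum_univ_two, if_pos h, if_neg fun h' => this ⟨h', h⟩]
        ring
    · have hcongr := fun s s' t => hS.maxPath_congr hfin (hcard ▸ hk2) s s' (t := t)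
      refine ⟨fun i => ⟨hcongr _ _ _, hcongr _ _ _⟩, fun i hi => ?_⟩
      rw [hentry, Fin.sum_univ_two, if_pos hi, if_pos (hcongr _ _ _ hi)]
      ring
    · have hone : ∀ s : Fin 2,
          ∑ i : Fin k, (if MaxPath S s (τ (Fin.castLE hk i)) then (1 : ℝ) else 0) = 1 := by
        intro s
        obtain ⟨_, ⟨⟨i, rfl⟩, hi⟩, huniq⟩ := hS.existsUnique_maxPath hfin h0 s
        rw [Finset.sum_eq_single i, if_pos hi]
        · intro j _ hj
          exact if_neg fun h => hj (hginj (huniq _ ⟨⟨j, rfl⟩, h⟩))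
        · simp
      simp only [Matrix.trace, Matrix.diag_apply, hentry, Finset.sum_sub_distrib]
      rw [Finset.sum_comm]
      simp [hone]

end UrnMST
end
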